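/- The interval [1,51] cannot be partitioned into 6 Sidon sets; equivalently, SR(6) = 51, where SR(k) is the least n such that [1,n] admits no partition into k Sidon sets. -/

import Mathlib

/-- A set of integers is a Sidon set if `a+b = c+d` with all four in `S`
implies `{a,b} = {c,d}`. -/
def IsSidon (S : Set ℤ) : Prop :=
  ∀ a ∈ S, ∀ b ∈ S, ∀ c ∈ S, ∀ d ∈ S, a + b = c + d → ({a, b} : Set ℤ) = {c, d}

/-- `[1,n]` can be partitioned into `k` Sidon sets. -/
def SidonPartition (n k : ℕ) : Prop :=
  ∃ P : Fin k → Set ℤ,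
    (∀ i, IsSidon (P i)) ∧
    (∀ i j, i ≠ j → Disjoint (P i) (P j)) ∧
    (⋃ i, P i) = Set.Icc (1 : ℤ) (n : ℤ)

/-- The Sidon–Ramsey number: least `n` with no partition of `[1,n]` into `k` Sidon sets. -/
noncomputable def SR (k : ℕ) : ℕ := sInf {n | ¬ SidonPartition n k}

namespace SidonRamsey

open Finset

/-- The Sidon property for finite sets of natural numbers. -/
def Sidon (A : Finset ℕ) : Prop :=
  ∀ a ∈ A, ∀ b ∈ A, ∀ c ∈ A, ∀ d ∈ A, a + b = c + d → a = c ∧ b = d ∨ a = d ∧ b = c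

theorem Sidon.mono {A B : Finset ℕ} (hB : Sidon B) (h : A ⊆ B) : Sidon A :=
  fun a ha b hb c hc d hd => hB a (h ha) b (h hb) c (h hc) d (h hd)

/-- The search for Sidon sets of eight elements visits the elements in order of decreasing weight,
and only keeps sets of large total weight. -/
def weight (x : ℕ) : ℕ :=
  [0, 0, 0, 3, 3, 4, 6, 8, 10, 12, 14, 15, 18, 18, 19, 21, 22, 23, 26, 26, 27, 28, 29, 28, 28, 28,
  27, 28, 28, 28, 29, 28, 27, 26, 26, 23, 22, 21, 19, 18, 18, 15, 14, 12, 10, 8, 6, 4, 3, 3,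
  0, 0].getD x 0

/-- The bitmask of a set in the low 52 bits, its total weight above them. -/
def code (A : Finset ℕ) : ℕ := ∑ x ∈ A, (2 ^ x + weight x * 2 ^ 52)

/-- The bitmask of a set. -/
def mask (A : Finset ℕ) : ℕ := ∑ x ∈ A, 2 ^ x

theorem code_eq (A : Finset ℕ) : code A = mask A + (∑ x ∈ A, weight x) * 2 ^ 52 := by
  rw [code, mask, sum_add_distrib, sum_mul]

theorem testBit_mask (A : Finset ℕ) (i : ℕ) : (mask A).testBit i = true ↔ i ∈ A := by
  rw [← Nat.mem_bitIndices, ← List.mem_toFinset, mask, Finset.toFinset_bitIndices_sum_two_pow]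

theorem eq_mask {A : Finset ℕ} {s : ℕ} (h : ∀ i, s.testBit i = true ↔ i ∈ A) : s = mask A :=
  Nat.eq_of_testBit_eq fun i => Bool.eq_iff_iff.2 ((h i).trans (testBit_mask A i).symm)

theorem mask_lt {A : Finset ℕ} (hA : A ⊆ Icc 1 51) : mask A < 2 ^ 52 := by
  refine Nat.lt_pow_two_of_testBit _ fun i hi => ?_
  rw [← Bool.not_eq_true, testBit_mask]
  intro h
  have := mem_Icc.1 (hA h)
  omega

theorem code_mod {A : Finset ℕ} (hA : A ⊆ Icc 1 51) : code A % 2 ^ 52 = mask A := by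
  rw [code_eq, Nat.add_mul_mod_self_right, Nat.mod_eq_of_lt (mask_lt hA)]

theorem code_div {A : Finset ℕ} (hA : A ⊆ Icc 1 51) :
    code A / 2 ^ 52 = ∑ x ∈ A, weight x := by
  rw [code_eq, Nat.add_mul_div_right _ _ (by norm_num), Nat.div_eq_of_lt (mask_lt hA), zero_add]

theorem testBit_code {A : Finset ℕ} (hA : A ⊆ Icc 1 51) {i : ℕ} (hi : i < 52) :
    (code A).testBit i = true ↔ i ∈ A := by
  rw [← testBit_mask, ← code_mod hA, Nat.testBit_mod_two_pow]
  simp [hi]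

theorem code_union {A B : Finset ℕ} (h : Disjoint A B) : code (A ∪ B) = code A + code B :=
  sum_union h

theorem land_mask_code {A B : Finset ℕ} (hA : A ⊆ Icc 1 51) (hB : B ⊆ Icc 1 51) :
    Nat.land (mask A) (code B) = mask (A ∩ B) := by
  refine eq_mask fun i => ?_
  change (mask A &&& code B).testBit i = true ↔ _
  rw [Nat.testBit_land, Bool.and_eq_true, testBit_mask, mem_inter]
  refine and_congr_right fun hi => testBit_code hB ?_
  have := mem_Icc.1 (hA hi)
  omega

/-- `s`, `v` are the bitmasks of `A` and of its reflection, and `d` records differences of `A`. -/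
structure Tracks (A : Finset ℕ) (s v d : ℕ) : Prop where
  testBit_fst : ∀ i, s.testBit i = true ↔ i ∈ A
  testBit_snd : ∀ i, v.testBit i = true ↔ 52 - i ∈ A
  testBit_diff : ∀ k, d.testBit k = true → 0 < k ∧ ∃ a ∈ A, a + k ∈ A

theorem tracks_empty : Tracks ∅ 0 0 0 := by
  constructor <;> simp

theorem Tracks.insert {A : Finset ℕ} {s v d : ℕ} (h : Tracks A s v d) (hA : A ⊆ Icc 1 51) {x : ℕ}
    (hx : x ∈ Icc 1 51) (hxA : x ∉ A) :
    Tracks (insert x A) (Nat.lor s (2 ^ x)) (Nat.lor v (2 ^ (52 - x)))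
      (Nat.lor d (Nat.lor (Nat.shiftRight s x) (Nat.shiftRight v (52 - x)))) := by
  rw [mem_Icc] at hx
  have h0 : 0 ∉ A := fun h => by simpa using hA h
  refine ⟨fun i => ?_, fun i => ?_, fun k hk => ?_⟩
  · change (s ||| 2 ^ x).testBit i = true ↔ _
    rw [Nat.testBit_lor, Bool.or_eq_true, h.testBit_fst, Nat.testBit_two_pow, mem_insert,
      decide_eq_true_iff, or_comm, eq_comm]
  · change (v ||| 2 ^ (52 - x)).testBit i = true ↔ _
    rw [Nat.testBit_lor, Bool.or_eq_true, h.testBit_snd, Nat.testBit_two_pow, mem_insert,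
      decide_eq_true_iff, or_comm]
    exact or_congr (by omega) Iff.rfl
  · change (d ||| (s >>> x ||| v >>> (52 - x))).testBit k = true at hk
    simp only [Nat.testBit_lor, Bool.or_eq_true, Nat.testBit_shiftRight, h.testBit_fst,
      h.testBit_snd] at hk
    rcases hk with hk | hk | hk
    · obtain ⟨h1, a, ha, h2⟩ := h.testBit_diff k hk
      exact ⟨h1, a, mem_insert_of_mem ha, mem_insert_of_mem h2⟩
    · refine ⟨Nat.pos_of_ne_zero ?_, x, mem_insert_self _ _, mem_insert_of_mem hk⟩
      rintro rfl
      exact hxA hk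
    · have : 52 - (52 - x + k) ≠ 0 := fun h => h0 (h ▸ hk)
      have e : 52 - (52 - x + k) + k = x := by omega
      refine ⟨Nat.pos_of_ne_zero ?_, _, mem_insert_of_mem hk, by simp [e]⟩
      rintro rfl
      exact hxA (by rwa [show 52 - (52 - x + 0) = x by omega] at hk)

theorem Tracks.compatible {A B : Finset ℕ} {s v d : ℕ} (h : Tracks A s v d) (hAB : A ⊆ B)
    (hB : Sidon B) (hB' : B ⊆ Icc 1 51) {x : ℕ} (hx : x ∈ B) (hxA : x ∉ A) :
    Nat.lor (Nat.land (Nat.shiftRight s x) (Nat.shiftRight v (52 - x)))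
      (Nat.land d (Nat.lor (Nat.shiftRight s x) (Nat.shiftRight v (52 - x)))) = 0 := by
  change (s >>> x &&& v >>> (52 - x)) ||| (d &&& (s >>> x ||| v >>> (52 - x))) = 0
  have h0 : 0 ∉ A := fun h => by simpa using hB' (hAB h)
  have hx' := mem_Icc.1 (hB' hx)
  refine Nat.eq_of_testBit_eq fun k => ?_
  rw [Nat.zero_testBit, ← Bool.not_eq_true]
  simp only [Nat.testBit_lor, Nat.testBit_land, Bool.or_eq_true, Bool.and_eq_true,
    Nat.testBit_shiftRight, h.testBit_fst, h.testBit_snd]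
  rintro (⟨h1, h2⟩ | ⟨hd, h1 | h2⟩)
  · have : 52 - (52 - x + k) ≠ 0 := fun h => h0 (h ▸ h2)
    rcases hB _ (hAB h1) _ (hAB h2) x hx x hx (by omega) with ⟨e, -⟩ | ⟨e, -⟩ <;>
      exact hxA (e ▸ h1)
  · obtain ⟨hk, a, ha, ha'⟩ := h.testBit_diff k hd
    rcases hB _ (hAB h1) _ (hAB ha) x hx _ (hAB ha') (by omega) with ⟨e, -⟩ | ⟨-, e⟩
    · exact hxA (e ▸ h1)
    · exact hxA (e ▸ ha)
  · obtain ⟨hk, a, ha, ha'⟩ := h.testBit_diff k hd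
    have : 52 - (52 - x + k) ≠ 0 := fun h => h0 (h ▸ h2)
    rcases hB _ (hAB h2) _ (hAB ha') x hx _ (hAB ha) (by omega) with ⟨e, -⟩ | ⟨-, e⟩
    · exact hxA (e ▸ h2)
    · exact hxA (e ▸ ha')

/-- A list of elements `x` of `[1,51]`, each stored with `52 - x`, `2 ^ x`, `2 ^ (52 - x)` and its
weight. -/
inductive Table
  | nil
  | cons (x y bx bY w : ℕ) (t : Table)

/-- The table of a list of elements. -/
def Table.ofList : List ℕ → Table
  | [] => .nil
  | x :: l => .cons x (52 - x) (2 ^ x) (2 ^ (52 - x)) (weight x) (ofList l)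

/-- The elements of `[1,51]` by decreasing weight. -/
def positions : List ℕ :=
  [22, 30, 21, 23, 24, 25, 27, 28, 29, 31, 20, 26, 32, 18, 19, 33, 34, 17, 35, 16, 36, 15, 37, 14,
  38, 12, 13, 39, 40, 11, 41, 10, 42, 9, 43, 8, 44, 7, 45, 6, 46, 5, 47, 3, 4, 48, 49, 1, 2, 50, 51]

/-- The table of `positions`. -/
def table : Table :=
  Table.cons (nat_lit 22) (nat_lit 30) (nat_lit 4194304) (nat_lit 1073741824) (nat_lit 29)
  (Table.cons (nat_lit 30) (nat_lit 22) (nat_lit 1073741824) (nat_lit 4194304) (nat_lit 29)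
  (Table.cons (nat_lit 21) (nat_lit 31) (nat_lit 2097152) (nat_lit 2147483648) (nat_lit 28)
  (Table.cons (nat_lit 23) (nat_lit 29) (nat_lit 8388608) (nat_lit 536870912) (nat_lit 28)
  (Table.cons (nat_lit 24) (nat_lit 28) (nat_lit 16777216) (nat_lit 268435456) (nat_lit 28)
  (Table.cons (nat_lit 25) (nat_lit 27) (nat_lit 33554432) (nat_lit 134217728) (nat_lit 28)
  (Table.cons (nat_lit 27) (nat_lit 25) (nat_lit 134217728) (nat_lit 33554432) (nat_lit 28)
  (Table.cons (nat_lit 28) (nat_lit 24) (nat_lit 268435456) (nat_lit 16777216) (nat_lit 28)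
  (Table.cons (nat_lit 29) (nat_lit 23) (nat_lit 536870912) (nat_lit 8388608) (nat_lit 28)
  (Table.cons (nat_lit 31) (nat_lit 21) (nat_lit 2147483648) (nat_lit 2097152) (nat_lit 28)
  (Table.cons (nat_lit 20) (nat_lit 32) (nat_lit 1048576) (nat_lit 4294967296) (nat_lit 27)
  (Table.cons (nat_lit 26) (nat_lit 26) (nat_lit 67108864) (nat_lit 67108864) (nat_lit 27)
  (Table.cons (nat_lit 32) (nat_lit 20) (nat_lit 4294967296) (nat_lit 1048576) (nat_lit 27)
  (Table.cons (nat_lit 18) (nat_lit 34) (nat_lit 262144) (nat_lit 17179869184) (nat_lit 26)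
  (Table.cons (nat_lit 19) (nat_lit 33) (nat_lit 524288) (nat_lit 8589934592) (nat_lit 26)
  (Table.cons (nat_lit 33) (nat_lit 19) (nat_lit 8589934592) (nat_lit 524288) (nat_lit 26)
  (Table.cons (nat_lit 34) (nat_lit 18) (nat_lit 17179869184) (nat_lit 262144) (nat_lit 26)
  (Table.cons (nat_lit 17) (nat_lit 35) (nat_lit 131072) (nat_lit 34359738368) (nat_lit 23)
  (Table.cons (nat_lit 35) (nat_lit 17) (nat_lit 34359738368) (nat_lit 131072) (nat_lit 23)
  (Table.cons (nat_lit 16) (nat_lit 36) (nat_lit 65536) (nat_lit 68719476736) (nat_lit 22)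
  (Table.cons (nat_lit 36) (nat_lit 16) (nat_lit 68719476736) (nat_lit 65536) (nat_lit 22)
  (Table.cons (nat_lit 15) (nat_lit 37) (nat_lit 32768) (nat_lit 137438953472) (nat_lit 21)
  (Table.cons (nat_lit 37) (nat_lit 15) (nat_lit 137438953472) (nat_lit 32768) (nat_lit 21)
  (Table.cons (nat_lit 14) (nat_lit 38) (nat_lit 16384) (nat_lit 274877906944) (nat_lit 19)
  (Table.cons (nat_lit 38) (nat_lit 14) (nat_lit 274877906944) (nat_lit 16384) (nat_lit 19)
  (Table.cons (nat_lit 12) (nat_lit 40) (nat_lit 4096) (nat_lit 1099511627776) (nat_lit 18)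
  (Table.cons (nat_lit 13) (nat_lit 39) (nat_lit 8192) (nat_lit 549755813888) (nat_lit 18)
  (Table.cons (nat_lit 39) (nat_lit 13) (nat_lit 549755813888) (nat_lit 8192) (nat_lit 18)
  (Table.cons (nat_lit 40) (nat_lit 12) (nat_lit 1099511627776) (nat_lit 4096) (nat_lit 18)
  (Table.cons (nat_lit 11) (nat_lit 41) (nat_lit 2048) (nat_lit 2199023255552) (nat_lit 15)
  (Table.cons (nat_lit 41) (nat_lit 11) (nat_lit 2199023255552) (nat_lit 2048) (nat_lit 15)
  (Table.cons (nat_lit 10) (nat_lit 42) (nat_lit 1024) (nat_lit 4398046511104) (nat_lit 14)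
  (Table.cons (nat_lit 42) (nat_lit 10) (nat_lit 4398046511104) (nat_lit 1024) (nat_lit 14)
  (Table.cons (nat_lit 9) (nat_lit 43) (nat_lit 512) (nat_lit 8796093022208) (nat_lit 12)
  (Table.cons (nat_lit 43) (nat_lit 9) (nat_lit 8796093022208) (nat_lit 512) (nat_lit 12)
  (Table.cons (nat_lit 8) (nat_lit 44) (nat_lit 256) (nat_lit 17592186044416) (nat_lit 10)
  (Table.cons (nat_lit 44) (nat_lit 8) (nat_lit 17592186044416) (nat_lit 256) (nat_lit 10)
  (Table.cons (nat_lit 7) (nat_lit 45) (nat_lit 128) (nat_lit 35184372088832) (nat_lit 8)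
  (Table.cons (nat_lit 45) (nat_lit 7) (nat_lit 35184372088832) (nat_lit 128) (nat_lit 8)
  (Table.cons (nat_lit 6) (nat_lit 46) (nat_lit 64) (nat_lit 70368744177664) (nat_lit 6)
  (Table.cons (nat_lit 46) (nat_lit 6) (nat_lit 70368744177664) (nat_lit 64) (nat_lit 6)
  (Table.cons (nat_lit 5) (nat_lit 47) (nat_lit 32) (nat_lit 140737488355328) (nat_lit 4)
  (Table.cons (nat_lit 47) (nat_lit 5) (nat_lit 140737488355328) (nat_lit 32) (nat_lit 4)
  (Table.cons (nat_lit 3) (nat_lit 49) (nat_lit 8) (nat_lit 562949953421312) (nat_lit 3)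
  (Table.cons (nat_lit 4) (nat_lit 48) (nat_lit 16) (nat_lit 281474976710656) (nat_lit 3)
  (Table.cons (nat_lit 48) (nat_lit 4) (nat_lit 281474976710656) (nat_lit 16) (nat_lit 3)
  (Table.cons (nat_lit 49) (nat_lit 3) (nat_lit 562949953421312) (nat_lit 8) (nat_lit 3)
  (Table.cons (nat_lit 1) (nat_lit 51) (nat_lit 2) (nat_lit 2251799813685248) (nat_lit 0)
  (Table.cons (nat_lit 2) (nat_lit 50) (nat_lit 4) (nat_lit 1125899906842624) (nat_lit 0)
  (Table.cons (nat_lit 50) (nat_lit 2) (nat_lit 1125899906842624) (nat_lit 4) (nat_lit 0)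
  (Table.cons (nat_lit 51) (nat_lit 1) (nat_lit 2251799813685248) (nat_lit 2) (nat_lit 0)
  Table.nil))))))))))))))))))))))))))))))))))))))))))))))))))

theorem table_eq : table = Table.ofList positions := by
  rfl

theorem mem_positions {x : ℕ} : x ∈ positions ↔ x ∈ Icc 1 51 := by
  rw [← List.mem_toFinset]
  exact iff_of_eq (congrArg (x ∈ ·) (by decide +kernel))

theorem nodup_positions : positions.Nodup := by
  decide +kernel

theorem pairwise_positions : positions.Pairwise fun x y => weight y ≤ weight x := by
  decide +kernel

/-- The search for all Sidon sets of weight at least `152` obtained by adding `r` elements of a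
table to the set tracked by `s`, `v`, `d`, of weight `w`; each must satisfy `leaf`. -/
noncomputable def heavySearch (leaf : ℕ → ℕ → Bool) (t : Table) : ℕ → ℕ → ℕ → ℕ → ℕ → Bool :=
  Table.rec
    (fun r s _ _ w => Nat.rec (leaf s w) (fun _ _ => true) r)
    (fun x y bx bY wx _ ih r s v d w =>
      Nat.rec (leaf s w)
        (fun r' _ =>
          Bool.rec
            ((fun c =>
                Bool.rec (ih r s v d w)
                  (Bool.rec false (ih r s v d w)
                    (ih r' (Nat.lor s bx) (Nat.lor v bY) (Nat.lor d c) (Nat.add w wx)))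
                  (Nat.beq
                    (Nat.lor (Nat.land (Nat.shiftRight s x) (Nat.shiftRight v y)) (Nat.land d c))
                    (nat_lit 0)))
              (Nat.lor (Nat.shiftRight s x) (Nat.shiftRight v y)))
            true (Nat.ble (Nat.add w (Nat.mul r wx)) (nat_lit 151)))
        r)
    t

theorem heavySearch_sound {leaf : ℕ → ℕ → Bool} {B : Finset ℕ} (hB : Sidon B)
    (hB' : B ⊆ Icc 1 51) (hw : 152 ≤ ∑ x ∈ B, weight x) (l : List ℕ) (hl : l.Nodup)
    (hl' : l.Pairwise fun x y => weight y ≤ weight x) :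
    ∀ (A : Finset ℕ) (r s v d : ℕ), Tracks A s v d → A ⊆ B → (∀ x ∈ B, x ∉ A → x ∈ l) →
      (∀ x ∈ A, x ∉ l) → #(B \ A) = r →
      heavySearch leaf (Table.ofList l) r s v d (∑ x ∈ A, weight x) = true →
      leaf (mask B) (∑ x ∈ B, weight x) = true := by
  have base : ∀ (A : Finset ℕ) (s v d : ℕ), Tracks A s v d → A ⊆ B → #(B \ A) = 0 →
      leaf s (∑ x ∈ A, weight x) = true → leaf (mask B) (∑ x ∈ B, weight x) = true := by
    intro A s v d ht hAB hr h
    rw [card_eq_zero, sdiff_eq_empty_iff_subset] at hr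
    obtain rfl := hAB.antisymm hr
    rwa [← eq_mask ht.testBit_fst]
  induction l with
  | nil =>
    intro A r s v d ht hAB h1 h2 hr h
    have : B \ A = ∅ := by
      ext x
      simpa using fun hx => h1 x hx
    rw [this, card_empty] at hr
    subst hr
    exact base A s v d ht hAB (by rw [this, card_empty]) h
  | cons x l ih =>
    intro A r s v d ht hAB h1 h2 hr h
    obtain _ | r := r
    · exact base A s v d ht hAB hr h
    rw [List.nodup_cons] at hl
    rw [List.pairwise_cons] at hl'
    have hxA : x ∉ A := fun hx => h2 x hx List.mem_cons_self
    have prune :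
        Nat.ble (Nat.add (∑ x ∈ A, weight x) (Nat.mul (r + 1) (weight x))) 151 = false := by
      rw [← Bool.not_eq_true, Nat.ble_eq]
      change ¬ (∑ x ∈ A, weight x) + (r + 1) * weight x ≤ 151
      have : ∑ y ∈ B \ A, weight y ≤ #(B \ A) • weight x := by
        refine sum_le_card_nsmul _ _ _ fun y hy => ?_
        rw [mem_sdiff] at hy
        rcases List.mem_cons.1 (h1 y hy.1 hy.2) with rfl | hy
        · exact le_rfl
        · exact hl'.1 y hy
      rw [hr, smul_eq_mul] at this
      have e := sum_sdiff (f := weight) hAB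
      omega
    have key : ∀ {p q : Bool} {n : ℕ},
        (Bool.rec (Bool.rec p (Bool.rec false p q) (Nat.beq n 0)) true
        (Nat.ble (Nat.add (∑ x ∈ A, weight x) (Nat.mul (r + 1) (weight x))) 151) : Bool) = true →
        p = true ∧ (n = 0 → q = true) := by
      intro p q n hpq
      rw [prune] at hpq
      obtain _ | n := n
      · cases q
        · cases hpq
        · exact ⟨hpq, fun _ => rfl⟩
      · exact ⟨hpq, fun h => by cases h⟩
    obtain ⟨hskip, htake⟩ := key h
    by_cases hx : x ∈ B
    · have hA := hAB.trans hB'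
      have hsub : insert x A ⊆ B := insert_subset hx hAB
      refine ih hl.2 hl'.2 (insert x A) r _ _ _ (ht.insert hA (hB' hx) hxA) hsub ?_ ?_ ?_ ?_
      · intro y hy hyA
        rw [mem_insert, not_or] at hyA
        exact (List.mem_cons.1 (h1 y hy hyA.2)).resolve_left hyA.1
      · intro y hy
        rcases mem_insert.1 hy with rfl | hy
        · exact hl.1
        · exact fun h => h2 y hy (List.mem_cons_of_mem _ h)
      · rw [card_sdiff_of_subset hsub, card_insert_of_notMem hxA]
        rw [card_sdiff_of_subset hAB] at hr
        omega
      · rw [sum_insert hxA, add_comm]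
        exact htake (ht.compatible hAB hB hB' hx hxA)
    · refine ih hl.2 hl'.2 A (r + 1) s v d ht hAB ?_ ?_ hr hskip
      · intro y hy hyA
        refine (List.mem_cons.1 (h1 y hy hyA)).resolve_left ?_
        rintro rfl
        exact hx hy
      · exact fun y hy h => h2 y hy (List.mem_cons_of_mem _ h)

/-- The search for the Sidon sets with maximum `50`, in decreasing order of their elements: `m` is
the bitmask of the elements found so far, shifted by the current position `n`, and `D` that of their
differences. The elements still to be found are at least the entries of the list. Each set, shifted
by its minimum, must satisfy `leaf`. -/
noncomputable def rulerSearch (leaf : ℕ → Bool) (n : ℕ) : List ℕ → ℕ → ℕ → Bool :=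
  Nat.rec (fun l m _ => List.rec (leaf m) (fun _ _ _ => true) l)
    (fun n ih l m D =>
      List.rec (leaf m)
        (fun t ts _ =>
          Bool.rec true
            ((fun m' =>
                Bool.rec (ih l m' D)
                  (Bool.rec false (ih l m' D) (ih ts (Nat.lor m' (nat_lit 1)) (Nat.lor D m')))
                  (Nat.beq (Nat.land m' D) (nat_lit 0)))
              (Nat.shiftLeft m (nat_lit 1)))
            (Nat.ble t n))
        l)
    n

/-- The entries `f (r - 1), …, f 0`. -/
def downList (f : ℕ → ℕ) : ℕ → List ℕ
  | 0 => []
  | r + 1 => f r :: downList f r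

theorem rulerSearch_sound {leaf : ℕ → Bool} {f : ℕ → ℕ} {B : Finset ℕ} (hB : Sidon B)
    (hf : ∀ x ∈ B, f #{y ∈ B | y < x} ≤ x) (n : ℕ) :
    ∀ r m D : ℕ, (∀ j, m.testBit j = true ↔ n + j ∈ B) →
      (∀ k, D.testBit k = true → 0 < k ∧ ∃ a ∈ B, n ≤ a ∧ a + k ∈ B) →
      #{y ∈ B | y < n} = r → (r = 0 → n ∈ B) → rulerSearch leaf n (downList f r) m D = true →
      ∃ q, ∃ b ∈ B, (∀ x ∈ B, b ≤ x) ∧ (∀ j, q.testBit j = true ↔ b + j ∈ B) ∧ leaf q = true := by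
  have base : ∀ n m : ℕ, (∀ j, m.testBit j = true ↔ n + j ∈ B) → #{y ∈ B | y < n} = 0 → n ∈ B →
      leaf m = true →
      ∃ q, ∃ b ∈ B, (∀ x ∈ B, b ≤ x) ∧ (∀ j, q.testBit j = true ↔ b + j ∈ B) ∧ leaf q = true := by
    intro n m hm hr hn h
    rw [card_eq_zero, filter_eq_empty_iff] at hr
    exact ⟨m, n, hn, fun x hx => not_lt.1 (hr hx), hm, h⟩
  induction n with
  | zero =>
    intro r m D hm hD hr hn h
    obtain rfl : r = 0 := by simpa using hr.symm
    exact base 0 m hm hr (hn rfl) h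
  | succ n ih =>
    intro r m D hm hD hr hn h
    obtain _ | r := r
    · exact base _ m hm hr (hn rfl) h
    have prune : Nat.ble (f r) n = true := by
      rw [Nat.ble_eq]
      have hne : {y ∈ B | y < n + 1}.Nonempty := by
        rw [← card_pos, hr]
        omega
      obtain ⟨hz, hzn⟩ := mem_filter.1 (max'_mem _ hne)
      set z := {y ∈ B | y < n + 1}.max' hne
      have e : {y ∈ B | y < z} = {y ∈ B | y < n + 1}.erase z := by
        ext y
        simp only [mem_filter, mem_erase]
        constructor
        · rintro ⟨h1, h2⟩
          exact ⟨h2.ne, h1, by omega⟩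
        · rintro ⟨h1, h2, h3⟩
          exact ⟨h2, lt_of_le_of_ne (le_max' _ _ (mem_filter.2 ⟨h2, h3⟩)) h1⟩
      have := hf z hz
      rw [e, card_erase_of_mem (max'_mem _ hne), hr] at this
      simp only [add_tsub_cancel_right] at this
      omega
    have key : ∀ {p q : Bool} {c : ℕ}, (Bool.rec true
        (Bool.rec p (Bool.rec false p q) (Nat.beq c 0)) (Nat.ble (f r) n) : Bool) = true →
        p = true ∧ (c = 0 → q = true) := by
      intro p q c hpq
      rw [prune] at hpq
      obtain _ | c := c
      · cases q
        · cases hpq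
        · exact ⟨hpq, fun _ => rfl⟩
      · exact ⟨hpq, fun h => by cases h⟩
    obtain ⟨hskip, htake⟩ := key h
    have hm' : ∀ j, (Nat.shiftLeft m 1).testBit j = true ↔ 1 ≤ j ∧ n + j ∈ B := by
      intro j
      change (m <<< 1).testBit j = true ↔ _
      rw [Nat.testBit_shiftLeft, Bool.and_eq_true, decide_eq_true_iff]
      refine and_congr_right fun hj => ?_
      rw [hm, show n + 1 + (j - 1) = n + j by omega]
    by_cases hnB : n ∈ B
    · have hcard : #{y ∈ B | y < n} = r := by
        have e : {y ∈ B | y < n + 1} = insert n {y ∈ B | y < n} := by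
          ext y
          simp only [mem_filter, mem_insert]
          constructor
          · rintro ⟨h1, h2⟩
            rcases Nat.lt_succ_iff_lt_or_eq.1 h2 with h3 | h3
            · exact .inr ⟨h1, h3⟩
            · exact .inl h3
          · rintro (rfl | ⟨h1, h2⟩)
            · exact ⟨hnB, by omega⟩
            · exact ⟨h1, by omega⟩
        rw [e, card_insert_of_notMem (by simp)] at hr
        omega
      refine ih r _ _ (fun j => ?_) (fun k hk => ?_) hcard (fun _ => hnB) (htake ?_)
      · change ((Nat.shiftLeft m 1) ||| 1).testBit j = true ↔ _
        rw [Nat.testBit_lor, Bool.or_eq_true, hm', Nat.testBit_one_eq_true_iff_self_eq_zero]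
        constructor
        · rintro (h1 | rfl)
          · exact h1.2
          · exact hnB
        · intro h1
          obtain rfl | h0 := Nat.eq_zero_or_pos j
          · exact .inr rfl
          · exact .inl ⟨h0, h1⟩
      · change (D ||| (Nat.shiftLeft m 1)).testBit k = true at hk
        rw [Nat.testBit_lor, Bool.or_eq_true, hm'] at hk
        rcases hk with hk | ⟨h1, h2⟩
        · obtain ⟨h1, a, h2, h3, h4⟩ := hD k hk
          exact ⟨h1, a, h2, by omega, h4⟩
        · exact ⟨h1, n, hnB, le_rfl, h2⟩
      · change (Nat.shiftLeft m 1) &&& D = 0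
        refine Nat.eq_of_testBit_eq fun k => ?_
        rw [Nat.zero_testBit, ← Bool.not_eq_true, Nat.testBit_land, Bool.and_eq_true, hm']
        rintro ⟨⟨h1, h2⟩, h3⟩
        obtain ⟨-, a, h4, h5, h6⟩ := hD k h3
        rcases hB _ h2 _ h4 _ hnB _ h6 (by omega) with ⟨h7, -⟩ | ⟨-, h7⟩ <;> omega
    · have e : {y ∈ B | y < n} = {y ∈ B | y < n + 1} := by
        ext y
        simp only [mem_filter]
        refine and_congr_right fun hy => ⟨fun h => by omega, fun h => ?_⟩
        rcases Nat.lt_succ_iff_lt_or_eq.1 h with h | rfl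
        · exact h
        · exact absurd hy hnB
      refine ih (r + 1) _ D (fun j => ?_) (fun k hk => ?_) (e ▸ hr) (by simp) hskip
      · rw [hm']
        refine and_iff_right_of_imp fun h => Nat.pos_of_ne_zero ?_
        rintro rfl
        exact hnB h
      · obtain ⟨h1, a, h2, h3, h4⟩ := hD k hk
        exact ⟨h1, a, h2, by omega, h4⟩

theorem Sidon.card_mul_le {A : Finset ℕ} (hA : Sidon A) {a b : ℕ} (h : A ⊆ Icc a b) :
    #A * (#A - 1) ≤ 2 * (b - a) := by
  have hsub : A.offDiag.image (fun p => (p.1 : ℤ) - p.2) ⊆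
      (Icc (-((b - a : ℕ) : ℤ)) ((b - a : ℕ) : ℤ)).erase 0 := by
    intro z hz
    obtain ⟨⟨x, y⟩, hp, rfl⟩ := mem_image.1 hz
    obtain ⟨hx, hy, hxy⟩ := mem_offDiag.1 hp
    have hx := mem_Icc.1 (h hx)
    have hy := mem_Icc.1 (h hy)
    simp only [mem_erase, mem_Icc] at hxy ⊢
    omega
  have := card_le_card hsub
  rw [card_image_of_injOn, offDiag_card, card_erase_of_mem (by simp), Int.card_Icc] at this
  · rw [Nat.mul_sub_one]
    omega
  · rintro ⟨x, y⟩ hp ⟨x', y'⟩ hp' e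
    obtain ⟨hx, hy, hxy⟩ := mem_offDiag.1 (mem_coe.1 hp)
    obtain ⟨hx', hy', hxy'⟩ := mem_offDiag.1 (mem_coe.1 hp')
    simp only at *
    rcases hA x hx y' hy' x' hx' y hy (by omega) with ⟨rfl, rfl⟩ | ⟨rfl, -⟩
    · rfl
    · exact absurd rfl hxy

theorem Sidon.card_le {A : Finset ℕ} (hA : Sidon A) (hA' : A ⊆ Icc 1 51) : #A ≤ 9 := by
  by_contra! hc
  obtain ⟨C, hCA, hC⟩ := exists_subset_card_eq (show 10 ≤ #A from hc)
  set f := C.orderEmbOfFin hC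
  have hf : ∀ i, f i ∈ C := orderEmbOfFin_mem C hC
  have hlt : ∀ i j : Fin 10, i < j → f i < f j := fun i j h => f.strictMono h
  set S : Finset (Fin 10 × Fin 10) :=
    {(0, 1), (1, 2), (2, 3), (3, 4), (4, 5), (5, 6), (6, 7), (7, 8), (8, 9),
      (0, 2), (1, 3), (2, 4), (3, 5), (4, 6), (5, 7), (6, 8), (7, 9)} with hS
  have hSlt : ∀ p ∈ S, p.1 < p.2 := by decide
  have hinj : Set.InjOn (fun p : Fin 10 × Fin 10 => (f p.2 : ℤ) - f p.1) S := by
    rintro ⟨i, j⟩ hp ⟨i', j'⟩ hp' e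
    have h1 := hlt _ _ (hSlt _ (mem_coe.1 hp))
    simp only at e h1
    rcases hA.mono hCA _ (hf j) _ (hf i') _ (hf j') _ (hf i) (by omega) with ⟨h2, h3⟩ | ⟨h2, -⟩
    · rw [f.injective h2, f.injective h3]
    · omega
  have hsum := sum_range_le_sum (s := S.image fun p : Fin 10 × Fin 10 => (f p.2 : ℤ) - f p.1)
    (c := 1) (by
      intro z hz
      obtain ⟨p, hp, rfl⟩ := mem_image.1 hz
      have h1 := hlt _ _ (hSlt p hp)
      omega)
  rw [card_image_of_injOn hinj, sum_image hinj, show #S = 17 by decide] at hsum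
  simp +decide [hS, sum_range_succ] at hsum
  have h0 := mem_Icc.1 (hA' (hCA (hf 0)))
  have h9 := mem_Icc.1 (hA' (hCA (hf 9)))
  have h01 := hlt 0 1 (by decide)
  have h89 := hlt 8 9 (by decide)
  omega

/-- Lower bounds for the elements of a Sidon set with maximum `50`, at most four of which are
smaller than `25`. -/
def lowerBound (k : ℕ) : ℕ :=
  [0, 1, 3, 6, 25, 26, 28, 31].getD k 0

theorem Sidon.lowerBound_le {B : Finset ℕ} (hB : Sidon B) (h : #{y ∈ B | y < 25} ≤ 4) {x : ℕ}
    (hx : x ∈ B) : lowerBound #{y ∈ B | y < x} ≤ x := by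
  set k := #{y ∈ B | y < x} with hk
  by_cases hk8 : 8 ≤ k
  · rw [lowerBound, List.getD_eq_default _ _ (by simpa using hk8)]
    exact Nat.zero_le _
  have hcard : ∀ c, #(insert x {y ∈ B | c ≤ y ∧ y < x}) = #{y ∈ B | c ≤ y ∧ y < x} + 1 :=
    fun c => card_insert_of_notMem (by simp)
  have hbound : ∀ c ≤ x, (#{y ∈ B | c ≤ y ∧ y < x} + 1) * #{y ∈ B | c ≤ y ∧ y < x} ≤
      2 * (x - c) := by
    intro c hc
    have := (hB.mono (insert_subset hx (filter_subset (fun y => c ≤ y ∧ y < x) B))).card_mul_le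
      (a := c) (b := x) (by
        intro y hy
        rw [mem_insert, mem_filter] at hy
        rw [mem_Icc]
        omega)
    rwa [hcard, Nat.add_sub_cancel] at this
  have h0 := hbound 0 (Nat.zero_le _)
  simp only [Nat.zero_le, true_and, ← hk] at h0
  have h25 : 4 ≤ k → 25 ≤ x ∧ k ≤ 4 + #{y ∈ B | 25 ≤ y ∧ y < x} := by
    intro hk4
    have hx25 : 25 ≤ x := by
      by_contra! hlt
      have : insert x {y ∈ B | y < x} ⊆ {y ∈ B | y < 25} := by
        intro y hy
        rw [mem_insert, mem_filter] at hy
        rw [mem_filter]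
        rcases hy with rfl | hy
        · exact ⟨hx, hlt⟩
        · exact ⟨hy.1, by omega⟩
      have := card_le_card this
      rw [card_insert_of_notMem (by simp)] at this
      omega
    refine ⟨hx25, ?_⟩
    have : {y ∈ B | y < x} ⊆ {y ∈ B | y < 25} ∪ {y ∈ B | 25 ≤ y ∧ y < x} := by
      intro y hy
      simp only [mem_union, mem_filter] at hy ⊢
      by_cases h : y < 25
      · exact .inl ⟨hy.1, h⟩
      · exact .inr ⟨hy.1, by omega, hy.2⟩
    have := (card_le_card this).trans (card_union_le _ _)
    omega
  have h1 := hbound 25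
  generalize #{y ∈ B | 25 ≤ y ∧ y < x} = j at h1 h25
  have hj : 4 ≤ k → (k - 4 + 1) * (k - 4) ≤ 2 * (x - 25) ∧ 25 ≤ x := by
    intro hk4
    obtain ⟨h2, h3⟩ := h25 hk4
    exact ⟨(Nat.mul_le_mul (by omega) (by omega)).trans (h1 h2), h2⟩
  clear_value k
  clear h1 h25 hcard hbound
  push Not at hk8
  interval_cases k <;> simp [lowerBound] at hj h0 ⊢ <;> omega

/-- The codes of all Sidon sets of nine elements in `[1,51]`. -/
def nines : List ℕ :=
  [nat_lit 376631179748575270, nat_lit 377319406377697546, nat_lit 385480530897944842,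
  nat_lit 385638585165946930, nat_lit 398711504071033366, nat_lit 399132071026557990,
  nat_lit 399839671184531466, nat_lit 399984755187124258, nat_lit 402157648121708810,
  nat_lit 402236675259899954, nat_lit 403160136203372582, nat_lit 403494929407443476,
  nat_lit 403635666367349798, nat_lit 403652709326528550, nat_lit 403652983683825764,
  nat_lit 403705554200961542, nat_lit 404207412438958154, nat_lit 404339362398994698,
  nat_lit 404341003202855234, nat_lit 404343271347724298, nat_lit 407664002219507750,
  nat_lit 407720936708509718, nat_lit 408156583831797798, nat_lit 408842412270567690,
  nat_lit 408842438065537346, nat_lit 408984240680731682, nat_lit 411239888785047622,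
  nat_lit 411243745791451174, nat_lit 412677571096875526, nat_lit 413215161418055818,
  nat_lit 413275703811777556, nat_lit 413346553089491476, nat_lit 415597940585922886,
  nat_lit 415774309091377670, nat_lit 416670960955981862, nat_lit 416724252780267542,
  nat_lit 416763287586734598, nat_lit 417216318590174214, nat_lit 417713542658129994,
  nat_lit 417717663679258772, nat_lit 417717670123668642, nat_lit 417796860862824484,
  nat_lit 417849740399608130, nat_lit 417992574872068130, nat_lit 420104151528177734,
  nat_lit 420242279815578662, nat_lit 420246547133894694, nat_lit 420250970698551372,
  nat_lit 420595083730092564, nat_lit 421508915065324042, nat_lit 421653913696477222,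
  nat_lit 421658382072578098, nat_lit 421684974363150342, nat_lit 421719918753367046,
  nat_lit 422214741398667402, nat_lit 422217137998921802, nat_lit 422282903066519588,
  nat_lit 422353760908477450, nat_lit 422354302083269652, nat_lit 422357634962718740,
  nat_lit 424046467649374246, nat_lit 424508246419048486, nat_lit 424780993216389644,
  nat_lit 425036560698769556, nat_lit 425731460889053206, nat_lit 425733110156501014,
  nat_lit 426012447044927754, nat_lit 426153389634880070, nat_lit 426154231435625030,
  nat_lit 426161920496640070, nat_lit 426163010479849542, nat_lit 426170741289975858,
  nat_lit 426188333740205062, nat_lit 426721012512587914, nat_lit 426786437766058506,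
  nat_lit 426786983198065162, nat_lit 426795230604562442, nat_lit 426795246978875402,
  nat_lit 426859001742099496, nat_lit 426859009799094916, nat_lit 426998089443182626,
  nat_lit 426999738710630434, nat_lit 428722123792515338, nat_lit 429249618665013830,
  nat_lit 429535213580783690, nat_lit 429566033460728330, nat_lit 429601458099585290,
  nat_lit 430181734068265010, nat_lit 430304887826813450, nat_lit 430516526668841282,
  nat_lit 430666609988862092, nat_lit 430666618562150498, nat_lit 430674324001669196,
  nat_lit 430674375306387608, nat_lit 430691934172881926, nat_lit 430728251346781196,
  nat_lit 430731481292742662, nat_lit 430731498606301190, nat_lit 431220222700029002,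
  nat_lit 431220763849393226, nat_lit 431224612127375498, nat_lit 431298829695860756,
  nat_lit 433066878349349126, nat_lit 434105332596474378, nat_lit 434808474569282058,
  nat_lit 434881038049771590, nat_lit 435169127804444748, nat_lit 435170218190307426,
  nat_lit 435230683276837126, nat_lit 435740929156972618, nat_lit 435741955679453480,
  nat_lit 435793805027837970, nat_lit 437698261717909578, nat_lit 438118011010818118,
  nat_lit 438291860553990406, nat_lit 438546818935046218, nat_lit 438573232715469842,
  nat_lit 439172436487833622, nat_lit 439382507398496650, nat_lit 439385196018532422,
  nat_lit 439387936220381324, nat_lit 439391260508176522, nat_lit 439525384015319050,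
  nat_lit 439664051598133286, nat_lit 439665013150976050, nat_lit 439666112650027078,
  nat_lit 439699372872827410, nat_lit 439716724674199570, nat_lit 439734420342064152,
  nat_lit 439734557253042700, nat_lit 440244474015154324, nat_lit 440297233393920018,
  nat_lit 440297782078081060, nat_lit 440297791739136010, nat_lit 440369817275367434,
  nat_lit 440510537593262146, nat_lit 442516046818578454, nat_lit 442760430557856902,
  nat_lit 442761255594246182, nat_lit 442765090463416418, nat_lit 442901425618683938,
  nat_lit 443077072593750026, nat_lit 443085611054678034, nat_lit 443112016513614466,
  nat_lit 443113085895442754, nat_lit 443613634804318486, nat_lit 443648818706251852,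
  nat_lit 443692526374752332, nat_lit 443745305083544598, nat_lit 443747517524353076,
  nat_lit 443815686709453844, nat_lit 443886313217983116, nat_lit 443956409298616838,
  nat_lit 443956475740815878, nat_lit 443956546737537542, nat_lit 444169750927392908,
  nat_lit 444739259331543122, nat_lit 444739277549535314, nat_lit 444739396770463826,
  nat_lit 444770045655269396, nat_lit 444871475577753620, nat_lit 445013046415329412,
  nat_lit 445016474739802146, nat_lit 445029538963931650, nat_lit 447004390721650726,
  nat_lit 447087824723251722, nat_lit 447264856832221254, nat_lit 447281339842970118,
  nat_lit 447617797918310410, nat_lit 447686504576189506, nat_lit 448145546588200982,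
  nat_lit 448152160702595110, nat_lit 448182929782218796, nat_lit 448182998450438170,
  nat_lit 448249055064097414, nat_lit 448284359663886342, nat_lit 448411645849378822,
  nat_lit 448671392049924172, nat_lit 448675579911471174, nat_lit 448681017071894724,
  nat_lit 448952622481736770, nat_lit 449234612594672914, nat_lit 449234683452997794,
  nat_lit 449243133805854996, nat_lit 449278043429830690, nat_lit 449304448771097610,
  nat_lit 449304981332561940, nat_lit 449374869172290820, nat_lit 449374937791332994,
  nat_lit 449516091874478210, nat_lit 450714009843277862, nat_lit 451066124147621958,
  nat_lit 451275031297786914, nat_lit 451558447859638316, nat_lit 451696971026022922,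
  nat_lit 452068603823529994, nat_lit 452084271848621074, nat_lit 452088395284881418,
  nat_lit 452119318784772106, nat_lit 452190099858524228, nat_lit 452630454517105178,
  nat_lit 452630456396415514, nat_lit 452633753320693798, nat_lit 452638152978334802,
  nat_lit 452664556289294410, nat_lit 452754149310791754, nat_lit 452756932982227032,
  nat_lit 452756932984307734, nat_lit 452774507719958534, nat_lit 452897657048809612,
  nat_lit 452910830250498058, nat_lit 452963610575503622, nat_lit 452968008615199490,
  nat_lit 453175270866683020, nat_lit 453175296888146188, nat_lit 453176946960924748,
  nat_lit 453178045407166738, nat_lit 453183785624666212, nat_lit 453192322138522630,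
  nat_lit 453194503982424070, nat_lit 453245151041564706, nat_lit 453245227277484418,
  nat_lit 453464992165925122, nat_lit 453465000770539778, nat_lit 453738212230432034,
  nat_lit 453738220820105482, nat_lit 453742335399035146, nat_lit 453755263771476050,
  nat_lit 453808039858817064, nat_lit 453878949769906256, nat_lit 453878958300071170,
  nat_lit 454019139590292514, nat_lit 456007638574972950, nat_lit 456132948572504162,
  nat_lit 456165386312762374, nat_lit 456271074721531954, nat_lit 456275373957578822,
  nat_lit 456275473808228402, nat_lit 456275885185564812, nat_lit 456587600925303828,
  nat_lit 456693184207127618, nat_lit 457159342677065798, nat_lit 457187107459825702,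
  nat_lit 457190163362218028, nat_lit 457326485724735524, nat_lit 457327018176939026,
  nat_lit 457397120626853126, nat_lit 457401237885689954, nat_lit 457410031311265802,
  nat_lit 457537578942366740, nat_lit 457537645514326538, nat_lit 457539778095644692,
  nat_lit 457539842654863370, nat_lit 457678320738306098, nat_lit 457678896515515922,
  nat_lit 457687109300453426, nat_lit 458245935145681060, nat_lit 458263253391786002,
  nat_lit 458311631367177236, nat_lit 458311785582166658, nat_lit 458382008165355586,
  nat_lit 458523014087188740, nat_lit 459721239230021670, nat_lit 460510791525797910,
  nat_lit 460511341287841842, nat_lit 460515052684840998, nat_lit 460530462490689558,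
  nat_lit 460563572443842586, nat_lit 460564539012812826, nat_lit 460598623671948306,
  nat_lit 460635998545117254, nat_lit 460668992350066722, nat_lit 460704443277529218,
  nat_lit 460775671015669798, nat_lit 460809725543454754, nat_lit 460811921361223686,
  nat_lit 460916373909422114, nat_lit 461058348382421074, nat_lit 461091196493169162,
  nat_lit 461654430182281238, nat_lit 461655520583893092, nat_lit 461759982895894580,
  nat_lit 461763002124206244, nat_lit 461763002124730516, nat_lit 461900711677920010,
  nat_lit 461902086053953674, nat_lit 461903735351672970, nat_lit 461905934407958724,
  nat_lit 461909233412735238, nat_lit 461970809888475148, nat_lit 462041724563267844,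
  nat_lit 462190785178108044, nat_lit 462208304601382930, nat_lit 462217100560177170,
  nat_lit 462217131564478482, nat_lit 462464486264541252, nat_lit 462465585827053636,
  nat_lit 462745136862857364, nat_lit 462762496856424978, nat_lit 462815273439725604,
  nat_lit 462885607807520788, nat_lit 462885633594099792, nat_lit 462886698989126916,
  nat_lit 463026405677205636, nat_lit 463027436209586306, nat_lit 463027507067650308,
  nat_lit 464310634998268170, nat_lit 464452403807258650, nat_lit 464455702342541350,
  nat_lit 464578855831617612, nat_lit 465034045995356212, nat_lit 465068138640187444,
  nat_lit 465138501210357830, nat_lit 465418908619769890, nat_lit 465419423755804738,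
  nat_lit 465419423764189252, nat_lit 465419432873697346, nat_lit 465419990686763140,
  nat_lit 465559749054694474, nat_lit 465564146967249034, nat_lit 465568409722159186,
  nat_lit 465630255135589416, nat_lit 466140175093793830, nat_lit 466157831708475974,
  nat_lit 466193479941759028, nat_lit 466193489059651636, nat_lit 466232513136691210,
  nat_lit 466265506551300148, nat_lit 466280892214547462, nat_lit 466298484400605190,
  nat_lit 466406240801554566, nat_lit 466408435127165446, nat_lit 466474441663054348,
  nat_lit 466685588829904966, nat_lit 466687711491654850, nat_lit 466694308016441350,
  nat_lit 466703138468987184, nat_lit 466720715085743116, nat_lit 466756430960558086,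
  nat_lit 466760280358027276, nat_lit 466969219754365192, nat_lit 467248607372779594,
  nat_lit 467250935379263650, nat_lit 467250952429109770, nat_lit 467253959036240162,
  nat_lit 467257807230469138, nat_lit 467283783155976210, nat_lit 467319104972263460,
  nat_lit 467319379873824778, nat_lit 467327627250958466, nat_lit 467389757182182664,
  nat_lit 467393665595343106, nat_lit 468972637373073430, nat_lit 468973603807825942,
  nat_lit 469221122647392404, nat_lit 469253979147108884, nat_lit 469254108004745748,
  nat_lit 469509194687516694, nat_lit 469544242693292108, nat_lit 469570913499615276,
  nat_lit 469571317126004870, nat_lit 469676201268478214, nat_lit 469790549671444632,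
  nat_lit 469790670199455896, nat_lit 469816920638620678, nat_lit 469816955398817816,
  nat_lit 470133584154396682, nat_lit 470133859028042372, nat_lit 470134129745199746,
  nat_lit 470204533784461442, nat_lit 470205048140873796, nat_lit 470639904972357898,
  nat_lit 470648168474804262, nat_lit 470661620314546220, nat_lit 470670142632632396,
  nat_lit 470696804700135450, nat_lit 470705332339884194, nat_lit 470802357801714242,
  nat_lit 470908325395955782, nat_lit 471189180271038534, nat_lit 471191379294289996,
  nat_lit 471206978346034690, nat_lit 471471140309581890, nat_lit 471756495554347156,
  nat_lit 471769657452527780, nat_lit 471787279833145412, nat_lit 471822429981810706,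
  nat_lit 471823533526286346, nat_lit 471892869322638594, nat_lit 472034635489480840,
  nat_lit 472034706322391556, nat_lit 472035735035216008, nat_lit 473177096760461334,
  nat_lit 473238609411973638, nat_lit 473317769824190730, nat_lit 473476234852960278,
  nat_lit 473652291946416162, nat_lit 473652575407703106, nat_lit 473724859709522196,
  nat_lit 473739980154343946, nat_lit 474022003863455770, nat_lit 474025855341887526,
  nat_lit 474039597593018406, nat_lit 474074508832018476, nat_lit 474075880940109906,
  nat_lit 474075880940372042, nat_lit 474091959151104006, nat_lit 474091959152091142,
  nat_lit 474157792946036756, nat_lit 474216068739514378, nat_lit 474285894111594020,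
  nat_lit 474302963376998424, nat_lit 474567121045569698, nat_lit 474637213905715842,
  nat_lit 474707686735286402, nat_lit 474708647768768580, nat_lit 475134435760013850,
  nat_lit 475151819643945010, nat_lit 475166113295007788, nat_lit 475173749809872972,
  nat_lit 475182610264358994, nat_lit 475201229078265894, nat_lit 475204529626292328,
  nat_lit 475272714915954792, nat_lit 475305957430280204, nat_lit 475411272172569862,
  nat_lit 475411923400130630, nat_lit 475428828403996682, nat_lit 475481605483331970,
  nat_lit 475481621590454340, nat_lit 475552008586200322, nat_lit 475692985588125796,
  nat_lit 475693948682108998, nat_lit 475696009452716306, nat_lit 475697111103701062,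
  nat_lit 475702606516191512, nat_lit 475710578779750704, nat_lit 475763087977230404,
  nat_lit 475976384712286468, nat_lit 475982990302790658, nat_lit 476256281217237316,
  nat_lit 476256798760796484, nat_lit 476265006477345360, nat_lit 476277655124181010,
  nat_lit 476326029611274250, nat_lit 476326030420779026, nat_lit 476326046537352202,
  nat_lit 476396441066016834, nat_lit 476396466937529604, nat_lit 476396672971186308,
  nat_lit 476539334663635080, nat_lit 476539370027942160, nat_lit 478089714977734732,
  nat_lit 478296903948443682, nat_lit 478296903948705826, nat_lit 478542919662571546,
  nat_lit 478542924221517850, nat_lit 478657036955943180, nat_lit 478790034905956486,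
  nat_lit 479070979444719778, nat_lit 479088002816672292, nat_lit 479105732177823762,
  nat_lit 479140796302427176, nat_lit 479211733039202562, nat_lit 479651227383242796,
  nat_lit 479774656417505368, nat_lit 479774665007439960, nat_lit 479775214529413142,
  nat_lit 479809557055676428, nat_lit 479917039683666060, nat_lit 479932461840597514,
  nat_lit 480205112803983634, nat_lit 480216135855243270, nat_lit 480478884774559876,
  nat_lit 480478903010345092, nat_lit 480759264785336586, nat_lit 480794518145208340,
  nat_lit 481040739627962402, nat_lit 482241410754417158, nat_lit 482308540829073482,
  nat_lit 482308609546453130, nat_lit 482589124864262214, nat_lit 482589126747489042,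
  nat_lit 482606457204786188, nat_lit 482738381286342930, nat_lit 482764909019398466,
  nat_lit 483029751766982708, nat_lit 483046523848892468, nat_lit 483063905314406690,
  nat_lit 483081506105852682, nat_lit 483082532594712602, nat_lit 483090235610136770,
  nat_lit 483293102014990722, nat_lit 483301335416966274, nat_lit 483310127333543942,
  nat_lit 483433822274207876, nat_lit 483433839570456836, nat_lit 483434372047835266,
  nat_lit 483578682930364712, nat_lit 483591619421949986, nat_lit 484173246107750452,
  nat_lit 484178741653668372, nat_lit 484191935591096340, nat_lit 484207603570705546,
  nat_lit 484208428340742662, nat_lit 484224921145198598, nat_lit 484224923022164120,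
  nat_lit 484242650500170308, nat_lit 484279071887589644, nat_lit 484295311091630468,
  nat_lit 484418712481431622, nat_lit 484436113037984280, nat_lit 484444824272912424,
  nat_lit 484726298443841604, nat_lit 484735165134835760, nat_lit 484735165403238406,
  nat_lit 484739495535591490, nat_lit 484770348433215536, nat_lit 484981454129860676,
  nat_lit 485263959379738762, nat_lit 485264101128274196, nat_lit 485265334840852802,
  nat_lit 485272755471123536, nat_lit 485273855535878210, nat_lit 485333262963589138,
  nat_lit 485333503490146344, nat_lit 486961055575183386, nat_lit 486987448266526746,
  nat_lit 487101261007561740, nat_lit 487163099476920450, nat_lit 487241981316694290,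
  nat_lit 487521531627323658, nat_lit 487524006182782086, nat_lit 487532805916491814,
  nat_lit 487585030588090886, nat_lit 487620213861263396, nat_lit 487657046453256468,
  nat_lit 487658146471346372, nat_lit 487796446024728770, nat_lit 487796689227251852,
  nat_lit 487805068305769986, nat_lit 487809328913612834, nat_lit 487813731254808612,
  nat_lit 487936907026632738, nat_lit 488082557427253800, nat_lit 488112931436765204,
  nat_lit 488646091495997478, nat_lit 488654303498633748, nat_lit 488677943032692840,
  nat_lit 488684559378939974, nat_lit 488693345255686218, nat_lit 488746134177579282,
  nat_lit 488746250127163412, nat_lit 488781451710432788, nat_lit 488782398725685300,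
  nat_lit 488851666072805394, nat_lit 488922723905437794, nat_lit 488923203851387146,
  nat_lit 488939627002200258, nat_lit 488939669690515992, nat_lit 489212305633480710,
  nat_lit 489221136073166866, nat_lit 489221376855526404, nat_lit 489221376856096774,
  nat_lit 489273882571178370, nat_lit 489486084046069896, nat_lit 489486118639641096,
  nat_lit 489766536802746634, nat_lit 489767705285493258, nat_lit 489777729607041092,
  nat_lit 489806041937093124, nat_lit 489836828491514498, nat_lit 489907334673342724,
  nat_lit 489907334940857346, nat_lit 491248635511113734, nat_lit 491477368356077668,
  nat_lit 491736819210651796, nat_lit 491737334074065034, nat_lit 491807711671894084,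
  nat_lit 492023757118899250, nat_lit 492053513723973670, nat_lit 492088902929621080,
  nat_lit 492106237938237958, nat_lit 492159039761813602, nat_lit 492160096324419682,
  nat_lit 492163395094315146, nat_lit 492229399949673736, nat_lit 492231565628148226,
  nat_lit 492300353287487586, nat_lit 492317339346272786, nat_lit 492334919729569826,
  nat_lit 492337126260736024, nat_lit 492585609441968290, nat_lit 492616415107351570,
  nat_lit 493155154854414436, nat_lit 493214665401176114, nat_lit 493219476548878858,
  nat_lit 493284916013827334, nat_lit 493285721591775380, nat_lit 493320116493091852,
  nat_lit 493355265974935572, nat_lit 493355308513497124, nat_lit 493356365076103204,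
  nat_lit 493430032490037388, nat_lit 493434430805246228, nat_lit 493443239253115402,
  nat_lit 493567472515973186, nat_lit 493570771872912388, nat_lit 493715905268687938,
  nat_lit 493715905781956882, nat_lit 493725805147389958, nat_lit 493742319309161508,
  nat_lit 493742578064171032, nat_lit 493777495345074182, nat_lit 494270128898183434,
  nat_lit 494271160780062794, nat_lit 494272335436710992, nat_lit 494278859500552516,
  nat_lit 494292053633794082, nat_lit 494411896124932228, nat_lit 495688463497101362,
  nat_lit 495730219152326978, nat_lit 495818188924388426, nat_lit 496029827474686022,
  nat_lit 496099921335189638, nat_lit 496108444760152082, nat_lit 496170290083536962,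
  nat_lit 496542749773267210, nat_lit 496561444557439138, nat_lit 496561475696500742,
  nat_lit 496574704196329482, nat_lit 496592778495590426, nat_lit 496609957289919042,
  nat_lit 496627961857114130, nat_lit 496663421073752596, nat_lit 496812138711506980,
  nat_lit 496821068351148044, nat_lit 497085429510570122, nat_lit 497085908392116500,
  nat_lit 497087026164662346, nat_lit 497089209132140578, nat_lit 497102437832722442,
  nat_lit 497155315059396674, nat_lit 497155727381528642, nat_lit 497665935665004566,
  nat_lit 497666725400610822, nat_lit 497718267691933772, nat_lit 497718686451253352,
  nat_lit 497719232448987212, nat_lit 497726930104123716, nat_lit 497735994901528976,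
  nat_lit 497790970283164684, nat_lit 497823955569083524, nat_lit 497929319767613636,
  nat_lit 497932532405240360, nat_lit 497946826259849226, nat_lit 498070040143333904,
  nat_lit 498211331548184964, nat_lit 498211534502101266, nat_lit 498212907820122380,
  nat_lit 498228309587400964, nat_lit 498228335341486086, nat_lit 498245893420556300,
  nat_lit 498281077794932748, nat_lit 498285492765458480, nat_lit 498492253551992900,
  nat_lit 498773938172723466, nat_lit 498774354516116612, nat_lit 498775935063970050,
  nat_lit 498808990206017576, nat_lit 498844167598776392, nat_lit 499055135864004866,
  nat_lit 500322055644790922, nat_lit 500357234782380066, nat_lit 500497830411243564,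
  nat_lit 500533428165836934, nat_lit 500533701973770516, nat_lit 500533701986746506,
  nat_lit 500744258450899106, nat_lit 500814386739808386, nat_lit 501043192733376556,
  nat_lit 501096239742320714, nat_lit 501104624489474060, nat_lit 501166336156647564,
  nat_lit 501175013605376268, nat_lit 501306934729777414, nat_lit 501307483286995212,
  nat_lit 501324561141227592, nat_lit 501588756390806082, nat_lit 501591157415871044,
  nat_lit 501606001759486500, nat_lit 501606074235756564, nat_lit 501623867758903332,
  nat_lit 501658846096789634, nat_lit 501729695760417028, nat_lit 501730263215145096,
  nat_lit 502173623564443654, nat_lit 502187650959081548, nat_lit 502188750504329304,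
  nat_lit 502221875372364294, nat_lit 502230592009617420, nat_lit 502257049009405962,
  nat_lit 502292645730599088, nat_lit 502327564853854232, nat_lit 502433181455090182,
  nat_lit 502714602610524354, nat_lit 502749501635715144, nat_lit 502749767659962416,
  nat_lit 502784679330496580, nat_lit 503277878981444866, nat_lit 503286054486360082,
  nat_lit 503287153965957186, nat_lit 503295434697998356, nat_lit 503312588763832392,
  nat_lit 504706623543972358, nat_lit 504720229933318282, nat_lit 504755276883169378,
  nat_lit 504825510325388578, nat_lit 504829768911946018, nat_lit 505036547024756806,
  nat_lit 505037851623161954, nat_lit 505040896492830854, nat_lit 505071678548640388,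
  nat_lit 505115710520954892, nat_lit 505115712935692294, nat_lit 505247858090901642,
  nat_lit 505248152278827284, nat_lit 505248957654368546, nat_lit 505250057650438468,
  nat_lit 505318226826641538, nat_lit 505540055444619334, nat_lit 505547754198597676,
  nat_lit 505556545996722186, nat_lit 505573176210882760, nat_lit 505600663901700614,
  nat_lit 505617019379402776, nat_lit 505634632830552082, nat_lit 505670895193358476,
  nat_lit 505670897320919308, nat_lit 505828125605699596, nat_lit 505828164124024844,
  nat_lit 505828262776414232, nat_lit 506092557916307732, nat_lit 506092628765311252,
  nat_lit 506093146292159016, nat_lit 506109673328349220, nat_lit 506127262559506468,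
  nat_lit 506232814468862212, nat_lit 506690426455998552, nat_lit 506734122950266886,
  nat_lit 506796258216640586, nat_lit 506813289968193560, nat_lit 506813330736809008,
  nat_lit 506817686339092528, nat_lit 506866066475995208, nat_lit 506867166239277136,
  nat_lit 506938632147566788, nat_lit 506939800318771210, nat_lit 506940848307437834,
  nat_lit 507217942929283090, nat_lit 507219042038190852, nat_lit 507235501024216082,
  nat_lit 507253163271700624, nat_lit 507253169982554136, nat_lit 507288277315231778,
  nat_lit 507782043531215426, nat_lit 507783057028219432, nat_lit 507789658508267588,
  nat_lit 507790755805267216, nat_lit 507816042896294984, nat_lit 507851261628910084,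
  nat_lit 507851776507052104, nat_lit 509082819608191046, nat_lit 509194834234589258,
  nat_lit 509258881323516044, nat_lit 509263008518641682, nat_lit 509267434214130050,
  nat_lit 509479055859417110, nat_lit 509482910576312468, nat_lit 509509290818540550,
  nat_lit 509522484945490962, nat_lit 509544485376491654, nat_lit 509546673928933386,
  nat_lit 509619241562968070, nat_lit 509619259144417316, nat_lit 509751325093806242,
  nat_lit 509751462012652100, nat_lit 509768810039871506, nat_lit 509786917219418626,
  nat_lit 510034866487689542, nat_lit 510037227653304396, nat_lit 510114021929664536,
  nat_lit 510120761000730636, nat_lit 510138211188641802, nat_lit 510175044564156968,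
  nat_lit 510349463177922056, nat_lit 510596157518414148, nat_lit 510615398983405826,
  nat_lit 510631067012579408, nat_lit 510667076545971204, nat_lit 511159116589433366,
  nat_lit 511167697413742744, nat_lit 511176493640974406, nat_lit 511177250746403084,
  nat_lit 511196216118215686, nat_lit 511202538189000710, nat_lit 511211368626651728,
  nat_lit 511334754454372376, nat_lit 511442231748591896, nat_lit 511443331235447888,
  nat_lit 511445531323531656, nat_lit 511722624368249928, nat_lit 511722745701073092,
  nat_lit 511792168462978064, nat_lit 512285698892497448, nat_lit 512285703422345858,
  nat_lit 512288856767219842, nat_lit 512289955448358024, nat_lit 512319644135588936,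
  nat_lit 512354826659643650, nat_lit 512355376132292768, nat_lit 512372422843303940,
  nat_lit 512566070299599368, nat_lit 512574745871917058, nat_lit 513622563802382418,
  nat_lit 513833807212708002, nat_lit 513834770084528292, nat_lit 513975592400455718,
  nat_lit 513982174567862294, nat_lit 513991039380361242, nat_lit 514114594755584196,
  nat_lit 514118447370612754, nat_lit 514131710162764548, nat_lit 514263615051663378,
  nat_lit 514272443360612362, nat_lit 514562662887129384, nat_lit 514580787681755154,
  nat_lit 514624355800989708, nat_lit 514642361507127336, nat_lit 514677046522155330,
  nat_lit 514712215798941744, nat_lit 514822130469310470, nat_lit 515099491922116932,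
  nat_lit 515104842445750306, nat_lit 515662844801319494, nat_lit 515681123910287890,
  nat_lit 515683048331674122, nat_lit 515751217843273764, nat_lit 515802899184391180,
  nat_lit 515838079748050992, nat_lit 515943735524074116, nat_lit 515945281646232616,
  nat_lit 515945835631084056, nat_lit 515952454173479170, nat_lit 516014074077646944,
  nat_lit 516226216462713112, nat_lit 516233903934019842, nat_lit 516507681811366152,
  nat_lit 516789193528050708, nat_lit 516867223168524290, nat_lit 516930994826446856,
  nat_lit 517070631764820488, nat_lit 518129495787571210, nat_lit 518520887704560652,
  nat_lit 518776111707996178, nat_lit 519042331240825610, nat_lit 519193788951429250,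
  nat_lit 519607755917492872, nat_lit 520169072676601930, nat_lit 520183383645552662,
  nat_lit 520185553556078662, nat_lit 520192162429665442, nat_lit 520200984299832868,
  nat_lit 520341683653837570, nat_lit 520447512184652056, nat_lit 520730944592807008,
  nat_lit 520755095479011332, nat_lit 520799221688047618, nat_lit 521362025885993218,
  nat_lit 521573201671749890, nat_lit 522735316440727714, nat_lit 522769539142811782,
  nat_lit 522778748494315526, nat_lit 522848634054905876, nat_lit 523033558768422932,
  nat_lit 523050877687218338, nat_lit 523051287806476554, nat_lit 523123443509039110,
  nat_lit 523139940213653516, nat_lit 523262292024885386, nat_lit 523554589238235142,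
  nat_lit 523561070351090450, nat_lit 523685298245730572, nat_lit 523688635703238668,
  nat_lit 523826031245672840, nat_lit 523826050497577520, nat_lit 523829330243100684,
  nat_lit 523965703574290946, nat_lit 524106476429513000, nat_lit 524106956400100388,
  nat_lit 524106995054150676, nat_lit 524124007429050404, nat_lit 524141608456684802,
  nat_lit 524678298777813044, nat_lit 524691351133225100, nat_lit 524691621702271554,
  nat_lit 524748527868331266, nat_lit 524845553352183952, nat_lit 524845690835173448,
  nat_lit 524955229881638918, nat_lit 524977220382621956, nat_lit 525249916176482376,
  nat_lit 525267491455385624, nat_lit 525795396084048464, nat_lit 525795827742934034,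
  nat_lit 525796394661874180, nat_lit 525796433333323816, nat_lit 525830578344329296,
  nat_lit 527222972411547654, nat_lit 527528155542724614, nat_lit 527555027137724550,
  nat_lit 527625121138016524, nat_lit 527625403263648024, nat_lit 527765856214909458,
  nat_lit 527774377695248964, nat_lit 527774381729384466, nat_lit 527774411794685972,
  nat_lit 527783310962204712, nat_lit 528126242638004760, nat_lit 528329085873685016,
  nat_lit 528341725568050178, nat_lit 528627667187023912, nat_lit 529177904588785172,
  nat_lit 529190892150456418, nat_lit 529195221729149506, nat_lit 529252121103582466,
  nat_lit 529384062750638338, nat_lit 529456639343854104, nat_lit 529463314258870296,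
  nat_lit 530299425206108808, nat_lit 530299972881492240, nat_lit 530334057710493768,
  nat_lit 531497875734020134, nat_lit 532028388048117772, nat_lit 532060275361218884,
  nat_lit 532137258958983174, nat_lit 532278013828534282, nat_lit 532557321727115554,
  nat_lit 532559728250191910, nat_lit 532560585901514758, nat_lit 532638754318321736,
  nat_lit 532638823059816484, nat_lit 532691397854200132, nat_lit 532832150249016354,
  nat_lit 533113953782401282, nat_lit 533114164269290632, nat_lit 533114174973166850,
  nat_lit 533685498235846678, nat_lit 533696415773310988, nat_lit 533698820956233740,
  nat_lit 533703219142991890, nat_lit 533823890940755988, nat_lit 533834906992708612,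
  nat_lit 533958581146370818, nat_lit 534240605327458840, nat_lit 534803151535084036,
  nat_lit 534803555331342888, nat_lit 534943201849524740, nat_lit 534943468252833856,
  nat_lit 535083932891775490, nat_lit 536091087941927174, nat_lit 536139532764973604,
  nat_lit 536139533025034402, nat_lit 536148275171033732, nat_lit 536253820226765324,
  nat_lit 536535357211021318, nat_lit 537058726658506778, nat_lit 537063331098787884,
  nat_lit 537098270925914720, nat_lit 537133431138584066, nat_lit 537205988707598432,
  nat_lit 537617274505406722, nat_lit 537617773660996106, nat_lit 537626005914256016,
  nat_lit 537626293687025674, nat_lit 537661188132307970, nat_lit 537757951613485572,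
  nat_lit 538184572846736012, nat_lit 538193487051883076, nat_lit 538200530812469260,
  nat_lit 538356352228065376, nat_lit 538470565321900038, nat_lit 538743107840393740,
  nat_lit 538751901555236876, nat_lit 539024649255715844, nat_lit 539306072578490898,
  nat_lit 539307154908185224, nat_lit 539323656171423008, nat_lit 540578194693062732,
  nat_lit 540643198965416212, nat_lit 540724434101665944, nat_lit 540735454856610322,
  nat_lit 540739956281182218, nat_lit 540854310020350276, nat_lit 540995197832661018,
  nat_lit 541034498402287884, nat_lit 541038954428761124, nat_lit 541311633340238352,
  nat_lit 541631522739978250, nat_lit 541645953569947696, nat_lit 541702993947460232,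
  nat_lit 541839641553176066, nat_lit 541857064624881760, nat_lit 542138397870261384,
  nat_lit 542191178194362626, nat_lit 542191311396017184, nat_lit 542697086678876180,
  nat_lit 542701899725406284, nat_lit 542965792984008714, nat_lit 542974032610460944,
  nat_lit 543246743723055172, nat_lit 543248904093179922, nat_lit 543248904225850128,
  nat_lit 543530413419937800, nat_lit 545041176752308362, nat_lit 545045514668802370,
  nat_lit 545217858817507402, nat_lit 545236826470744198, nat_lit 545375393939719432,
  nat_lit 545520512546242864, nat_lit 545850352890028290, nat_lit 546062040008233012,
  nat_lit 546068120609038346, nat_lit 546081246170646538, nat_lit 546484783979569156,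
  nat_lit 547205505795227736, nat_lit 547231353981110290, nat_lit 547275385449481408,
  nat_lit 547328229691621894, nat_lit 547471028738327170, nat_lit 547471038120726538,
  nat_lit 547750927449263108, nat_lit 547751404216256530, nat_lit 547752572992096516,
  nat_lit 547785773592674496, nat_lit 547820965481963536, nat_lit 548322056228339746,
  nat_lit 548348440083433744, nat_lit 549544743093142802, nat_lit 549584307259181106,
  nat_lit 549729459979161700, nat_lit 550090083678553112, nat_lit 550287979667784008,
  nat_lit 550777262874690064, nat_lit 550847663579333762, nat_lit 551691796167004682,
  nat_lit 551692225664271366, nat_lit 551730537056833556, nat_lit 551994420640219328,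
  nat_lit 552115371210179616, nat_lit 552263808501178370, nat_lit 552821531479281666,
  nat_lit 553982405640200262, nat_lit 554260513094770694, nat_lit 554262162429198360,
  nat_lit 554365241528484392, nat_lit 554369381862739978, nat_lit 554507361977925780,
  nat_lit 554510241887420438, nat_lit 554578293630701574, nat_lit 554655308836782128,
  nat_lit 554787462598109328, nat_lit 554787473306157578, nat_lit 555073189894424962,
  nat_lit 555077759454413076, nat_lit 555367721638969860, nat_lit 555385459451637768,
  nat_lit 556207885561118730, nat_lit 556233045478473746, nat_lit 556249529645564932,
  nat_lit 556476050432333954, nat_lit 556757798138971650, nat_lit 556758613109244976,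
  nat_lit 556766301102817304, nat_lit 557321046659698832, nat_lit 557321553416816712,
  nat_lit 557391372471043200, nat_lit 557601946079364104, nat_lit 558763018515652870,
  nat_lit 558807030115208194, nat_lit 558868708009710664, nat_lit 558870834136612882,
  nat_lit 559085170319196208, nat_lit 559158837530140930, nat_lit 559582441371631622,
  nat_lit 559584348362784836, nat_lit 559642906047027716, nat_lit 559862525039771778,
  nat_lit 560704785039360592, nat_lit 560716364369625640, nat_lit 560733501205250580,
  nat_lit 560979671567632432, nat_lit 561824191490576900, nat_lit 561842196535312528,
  nat_lit 563029256368570508, nat_lit 563101703206998022, nat_lit 563109657552625676,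
  nat_lit 563253452992684044, nat_lit 563284480505184388, nat_lit 563548229547855106,
  nat_lit 563556952564056088, nat_lit 563556986936360978, nat_lit 563583282864734732,
  nat_lit 563671306063845380, nat_lit 563724567955181570, nat_lit 563794662893093512,
  nat_lit 564079169044021544, nat_lit 564089047502372882, nat_lit 564111175181156752,
  nat_lit 564216764829795074, nat_lit 564639370284388640, nat_lit 564639372364875024,
  nat_lit 564647874791997512, nat_lit 564674262573548096, nat_lit 565202923614117992,
  nat_lit 565225942558998664, nat_lit 565228141583433764, nat_lit 565483237070275208,
  nat_lit 565483576238278148, nat_lit 566328791308438048, nat_lit 567533405114339334,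
  nat_lit 567770764837716528, nat_lit 567884630336741520, nat_lit 568302513734025252,
  nat_lit 568597126754337034, nat_lit 568650371468247060, nat_lit 568720211935527960,
  nat_lit 568755383541176322, nat_lit 568861238780502084, nat_lit 569708655726297252,
  nat_lit 569712121747669010, nat_lit 569986896827157506, nat_lit 570285895540343044,
  nat_lit 570832386774835776, nat_lit 572115758570570008, nat_lit 572124416217989186,
  nat_lit 572313430011158552, nat_lit 572537763555975368, nat_lit 572592670532452364,
  nat_lit 572626206843797768, nat_lit 572801725799334948, nat_lit 572802127399879760,
  nat_lit 572819307252171040, nat_lit 573084704014860370, nat_lit 573110540415549954,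
  nat_lit 573228188388851736, nat_lit 573646298922616904, nat_lit 574218024131760900,
  nat_lit 574279596195742496, nat_lit 574560813661040644, nat_lit 576568521625438244,
  nat_lit 576883038865064466, nat_lit 577032775914225764, nat_lit 577729599459559616,
  nat_lit 577797760600785416, nat_lit 578782998841794566, nat_lit 579002823729020976,
  nat_lit 579839001822298178, nat_lit 581142490598346764, nat_lit 581250363736195122,
  nat_lit 581298604005134466, nat_lit 581533349215215650, nat_lit 582160672389876226,
  nat_lit 582654301378447520, nat_lit 583227421755834436, nat_lit 583252446374003088,
  nat_lit 583357456436966408, nat_lit 583638368525517840, nat_lit 585683490202193992,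
  nat_lit 585750938371884066, nat_lit 585767572838816258, nat_lit 586033925185603652,
  nat_lit 586066360767946762, nat_lit 586102375136232544, nat_lit 586136455706845444,
  nat_lit 586599486470684706, nat_lit 586611998779769032, nat_lit 586666436680771592,
  nat_lit 587731846067921168, nat_lit 587860592476328964, nat_lit 587864921803378704,
  nat_lit 588283323021803656, nat_lit 590060620519311366, nat_lit 590539053829456010,
  nat_lit 591097803280750626, nat_lit 592367391318032388, nat_lit 592821486130332680,
  nat_lit 593351450080842048, nat_lit 594529035473912850, nat_lit 595178993678815266,
  nat_lit 595882669586254082, nat_lit 596746742375940116, nat_lit 596868787652034600,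
  nat_lit 597012845125177728, nat_lit 599577993001579524, nat_lit 600110697695154312,
  nat_lit 600114546221793290, nat_lit 601248427518468106, nat_lit 601793787986973188,
  nat_lit 601794049976320258, nat_lit 608073979351139346, nat_lit 608162009007261732,
  nat_lit 609183869761265666, nat_lit 609254804903985312, nat_lit 610238453885448260,
  nat_lit 610523660112953664, nat_lit 617151755850878996, nat_lit 617310362752000040,
  nat_lit 617345267574247496, nat_lit 617627576554242128, nat_lit 617697386198737040,
  nat_lit 618401623447716128, nat_lit 622622807398815778, nat_lit 622694668643745794,
  nat_lit 623748866220503108, nat_lit 623892588710363140, nat_lit 635086850909800458,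
  nat_lit 637824496455156288]

/-- Membership in a list. -/
noncomputable def elem (e : ℕ) (l : List ℕ) : Bool :=
  List.rec false (fun y _ ih => Bool.rec ih true (Nat.beq e y)) l

theorem mem_of_elem {e : ℕ} {l : List ℕ} (h : elem e l = true) : e ∈ l := by
  induction l with
  | nil => cases h
  | cons y l ih =>
    by_cases hy : e = y
    · exact hy ▸ List.mem_cons_self
    · have hf : Nat.beq e y = false := by
        rw [← Bool.not_eq_true, Nat.beq_eq]
        exact hy
      change (Bool.rec (elem e l) true (Nat.beq e y) : Bool) = true at h
      rw [hf] at h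
      exact List.mem_cons_of_mem _ (ih h)

/-- The elements of the set with bitmask `m`, coded through a choice between `2 ^ x` and
`2 ^ (52 - x)`. -/
noncomputable def encode (b : ℕ → ℕ → ℕ) (m : ℕ) (t : Table) : ℕ :=
  Table.rec (nat_lit 0)
    (fun _ _ bx bY w _ ih =>
      Bool.rec (Nat.add ih (Nat.add (b bx bY) (Nat.mul w (nat_lit 4503599627370496)))) ih
        (Nat.beq (Nat.land m bx) (nat_lit 0)))
    t

theorem beq_land_two_pow (A : Finset ℕ) (x : ℕ) :
    Nat.beq (Nat.land (mask A) (2 ^ x)) 0 = decide (x ∉ A) := by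
  rw [Bool.eq_iff_iff, Nat.beq_eq, decide_eq_true_iff, ← testBit_mask A x]
  change mask A &&& 2 ^ x = 0 ↔ _
  rw [Nat.and_two_pow]
  cases (mask A).testBit x <;> simp

theorem encode_eq (b : ℕ → ℕ → ℕ) (A : Finset ℕ) (l : List ℕ) (hl : l.Nodup) :
    encode b (mask A) (Table.ofList l) =
      ∑ x ∈ l.toFinset with x ∈ A, (b (2 ^ x) (2 ^ (52 - x)) + weight x * 2 ^ 52) := by
  induction l with
  | nil => rfl
  | cons x l ih =>
    rw [List.nodup_cons] at hl
    change (Bool.rec (Nat.add (encode b (mask A) (Table.ofList l)) _)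
      (encode b (mask A) (Table.ofList l)) (Nat.beq (Nat.land (mask A) (2 ^ x)) 0) : ℕ) = _
    rw [beq_land_two_pow, ih hl.2, List.toFinset_cons, filter_insert]
    by_cases hx : x ∈ A
    · rw [if_pos hx, sum_insert (by simp [hl.1]), add_comm]
      simp only [hx, not_true_eq_false, decide_false]
      rfl
    · simp [hx]

theorem filter_positions {A : Finset ℕ} (hA : A ⊆ Icc 1 51) :
    {x ∈ positions.toFinset | x ∈ A} = A := by
  ext x
  simp only [mem_filter, List.mem_toFinset, mem_positions, and_iff_right_iff_imp]
  exact fun h => hA h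

/-- The reflection of a subset of `[1,51]`. -/
def reflect (A : Finset ℕ) : Finset ℕ := A.image fun x => 52 - x

theorem injOn_reflect {A : Finset ℕ} (hA : A ⊆ Icc 1 51) :
    Set.InjOn (fun x => 52 - x) (A : Set ℕ) := by
  intro x hx y hy h
  have := mem_Icc.1 (hA hx)
  have := mem_Icc.1 (hA hy)
  simp only at h
  omega

theorem mem_reflect {A : Finset ℕ} (hA : A ⊆ Icc 1 51) {x : ℕ} :
    x ∈ reflect A ↔ 52 - x ∈ A := by
  rw [reflect, mem_image]
  constructor
  · rintro ⟨y, hy, rfl⟩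
    have := mem_Icc.1 (hA hy)
    rwa [show 52 - (52 - y) = y by omega]
  · intro h
    have := mem_Icc.1 (hA h)
    exact ⟨_, h, by omega⟩

theorem reflect_subset {A : Finset ℕ} (hA : A ⊆ Icc 1 51) : reflect A ⊆ Icc 1 51 := by
  intro x hx
  rw [mem_reflect hA] at hx
  have := mem_Icc.1 (hA hx)
  rw [mem_Icc]
  omega

theorem reflect_reflect {A : Finset ℕ} (hA : A ⊆ Icc 1 51) : reflect (reflect A) = A := by
  ext x
  rw [mem_reflect (reflect_subset hA), mem_reflect hA]
  constructor
  · intro h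
    have := mem_Icc.1 (hA h)
    rwa [show 52 - (52 - x) = x by omega] at h
  · intro h
    have := mem_Icc.1 (hA h)
    rwa [show 52 - (52 - x) = x by omega]

theorem card_reflect {A : Finset ℕ} (hA : A ⊆ Icc 1 51) : #(reflect A) = #A :=
  card_image_of_injOn (injOn_reflect hA)

theorem Sidon.reflect {A : Finset ℕ} (h : Sidon A) (hA : A ⊆ Icc 1 51) : Sidon (reflect A) := by
  intro a ha b hb c hc d hd e
  have h1 := mem_Icc.1 (reflect_subset hA ha)
  have h2 := mem_Icc.1 (reflect_subset hA hb)
  have h3 := mem_Icc.1 (reflect_subset hA hc)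
  have h4 := mem_Icc.1 (reflect_subset hA hd)
  rw [mem_reflect hA] at ha hb hc hd
  have := h _ ha _ hb _ hc _ hd (by omega)
  omega

theorem weight_reflect : ∀ x ∈ Icc 1 51, weight (52 - x) = weight x := by
  decide

theorem code_reflect {A : Finset ℕ} (hA : A ⊆ Icc 1 51) :
    code (reflect A) = ∑ x ∈ A, (2 ^ (52 - x) + weight x * 2 ^ 52) := by
  rw [code, reflect, sum_image (injOn_reflect hA)]
  exact sum_congr rfl fun x hx => by rw [weight_reflect x (hA hx)]

/-- All translates of a set, and their reflections, occur in `nines`, as far as they lie in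
`[1,51]`. The table runs over the translations. -/
noncomputable def translatesListed (q : ℕ) (t : Table) : Bool :=
  Table.rec true
    (fun x _ _ _ _ _ ih =>
      Bool.rec
        (Bool.rec false
          (Bool.rec false ih (elem (encode (fun _ bY => bY) (Nat.shiftLeft q x) table) nines))
          (elem (encode (fun bx _ => bx) (Nat.shiftLeft q x) table) nines))
        ih (Nat.ble (nat_lit 4503599627370496) (Nat.shiftLeft q x)))
    t

theorem translatesListed_sound {q : ℕ} {A : Finset ℕ} (hA : A ⊆ Icc 1 51) {l : List ℕ} {x : ℕ}
    (hx : x ∈ l) (hq : Nat.shiftLeft q x = mask A)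
    (h : translatesListed q (Table.ofList l) = true) :
    code A ∈ nines ∧ code (reflect A) ∈ nines := by
  induction l with
  | nil => cases hx
  | cons y l ih =>
    have key : ∀ {b c d e : Bool}, (Bool.rec (Bool.rec false (Bool.rec false d c) b) d e : Bool) =
        true → d = true ∧ (e = false → b = true ∧ c = true) := by
      decide
    obtain ⟨h1, h2⟩ := key h
    rcases List.mem_cons.1 hx with rfl | hx
    · obtain ⟨h3, h4⟩ := h2 (by
        rw [← Bool.not_eq_true, Nat.ble_eq, hq]
        exact not_le.2 (mask_lt hA))
      have h3 := mem_of_elem h3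
      have h4 := mem_of_elem h4
      rw [hq, table_eq, encode_eq _ _ _ nodup_positions, filter_positions hA] at h3 h4
      rw [code_reflect hA]
      exact ⟨h3, h4⟩
    · exact ih hx h1

/-- The search for the Sidon sets whose two largest elements are `50` and `50 - g`. -/
noncomputable def rulerSearchFrom (g : ℕ) : Bool :=
  rulerSearch (fun q => translatesListed q table) (Nat.sub (nat_lit 50) g)
    [nat_lit 28, nat_lit 26, nat_lit 25, nat_lit 6, nat_lit 3, nat_lit 1, nat_lit 0]
    (Nat.lor (Nat.shiftLeft (nat_lit 1) g) (nat_lit 1)) (Nat.shiftLeft (nat_lit 1) g)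

set_option maxRecDepth 100000

theorem rulerSearchFrom_one : rulerSearchFrom 1 = true := by
  decide +kernel

theorem rulerSearchFrom_two : rulerSearchFrom 2 = true := by
  decide +kernel

theorem rulerSearchFrom_three : rulerSearchFrom 3 = true := by
  decide +kernel

theorem rulerSearchFrom_lt_six : ∀ i < 2, rulerSearchFrom (4 + i) = true := by
  decide +kernel

theorem rulerSearchFrom_lt_nine : ∀ i < 3, rulerSearchFrom (6 + i) = true := by
  decide +kernel

theorem rulerSearchFrom_lt_twenty : ∀ i < 11, rulerSearchFrom (9 + i) = true := by
  decide +kernel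

theorem rulerSearchFrom_eq_true {g : ℕ} (h : 1 ≤ g) (h' : g < 20) : rulerSearchFrom g = true := by
  rcases lt_or_ge g 9 with h9 | h9
  · rcases lt_or_ge g 6 with h6 | h6
    · rcases lt_or_ge g 4 with h4 | h4
      · interval_cases g
        exacts [rulerSearchFrom_one, rulerSearchFrom_two, rulerSearchFrom_three]
      · have := rulerSearchFrom_lt_six (g - 4) (by omega)
        rwa [Nat.add_sub_cancel' h4] at this
    · have := rulerSearchFrom_lt_nine (g - 6) (by omega)
      rwa [Nat.add_sub_cancel' h6] at this
  · have := rulerSearchFrom_lt_twenty (g - 9) (by omega)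
    rwa [Nat.add_sub_cancel' h9] at this

theorem code_mem_nines_of_le {A : Finset ℕ} (hA : Sidon A) (hA' : A ⊆ Icc 1 51) (hc : #A = 9)
    {M : ℕ} (hM : M ∈ A) (hmax : ∀ x ∈ A, x ≤ M) (h : #{x ∈ A | x + 25 < M} ≤ 4) :
    code A ∈ nines ∧ code (reflect A) ∈ nines := by
  have hM' := mem_Icc.1 (hA' hM)
  have hpos : ∀ x ∈ A, 1 ≤ x := fun x hx => (mem_Icc.1 (hA' hx)).1
  set B := A.image fun x => x + 50 - M with hBdef
  have hmem : ∀ y, y ∈ B ↔ y + M - 50 ∈ A ∧ 50 ≤ y + M := by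
    intro y
    rw [hBdef, mem_image]
    constructor
    · rintro ⟨x, hx, rfl⟩
      have := hpos x hx
      rw [show x + 50 - M + M - 50 = x by omega]
      exact ⟨hx, by omega⟩
    · rintro ⟨h1, h2⟩
      exact ⟨_, h1, by omega⟩
  have hinj : Set.InjOn (fun x => x + 50 - M) (A : Set ℕ) := by
    intro x hx y hy e
    have := hpos x hx
    have := hpos y hy
    simp only at e
    omega
  have hB : Sidon B := by
    intro a ha b hb c hc d hd e
    rw [hmem] at ha hb hc hd
    have := hA _ ha.1 _ hb.1 _ hc.1 _ hd.1 (by omega)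
    omega
  have hB50 : ∀ y ∈ B, y ≤ 50 := by
    intro y hy
    have := hmax _ ((hmem y).1 hy).1
    omega
  have h50 : 50 ∈ B := (hmem 50).2 ⟨by rwa [Nat.add_sub_cancel_left], by omega⟩
  have hBc : #B = 9 := by rw [hBdef, card_image_of_injOn hinj, hc]
  have h25 : #{y ∈ B | y < 25} ≤ 4 := by
    refine le_trans ?_ h
    rw [← card_image_of_injOn (hinj.mono (coe_subset.2 (filter_subset _ A)))]
    refine card_le_card fun y hy => ?_
    obtain ⟨hy, hy'⟩ := mem_filter.1 hy
    obtain ⟨h1, h2⟩ := (hmem y).1 hy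
    exact mem_image.2 ⟨_, mem_filter.2 ⟨h1, by omega⟩, by omega⟩
  have hne : (B.erase 50).Nonempty := by
    rw [← card_pos, card_erase_of_mem h50, hBc]
    norm_num
  set n := (B.erase 50).max' hne with hn
  obtain ⟨hn50, hnB⟩ := mem_erase.1 ((B.erase 50).max'_mem hne)
  rw [← hn] at hn50 hnB
  have hnmax : ∀ y ∈ B, y = 50 ∨ y ≤ n := by
    intro y hy
    by_cases h : y = 50
    · exact .inl h
    · exact .inr (le_max' _ _ (mem_erase.2 ⟨h, hy⟩))
  have hn50' := hB50 n hnB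
  have hcard : #{y ∈ B | y < n} = 7 := by
    have e : {y ∈ B | y < n} = (B.erase 50).erase n := by
      ext y
      simp only [mem_filter, mem_erase]
      constructor
      · rintro ⟨h1, h2⟩
        exact ⟨h2.ne, by omega, h1⟩
      · rintro ⟨h1, h2, h3⟩
        have := hnmax y h3
        exact ⟨h3, by omega⟩
    rw [e, card_erase_of_mem (mem_erase.2 ⟨hn50, hnB⟩), card_erase_of_mem h50, hBc]
  have hn31 : 31 ≤ n := by
    have := hB.lowerBound_le h25 hnB
    rwa [hcard] at this
  have hsearch : rulerSearch (fun q => translatesListed q table) (50 - (50 - n))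
      (downList lowerBound 7) (Nat.lor (Nat.shiftLeft 1 (50 - n)) 1)
      (Nat.shiftLeft 1 (50 - n)) = true :=
    rulerSearchFrom_eq_true (g := 50 - n) (by omega) (by omega)
  rw [show 50 - (50 - n) = n by omega] at hsearch
  have hbit : ∀ j, (Nat.shiftLeft 1 (50 - n)).testBit j = true ↔ j = 50 - n := by
    intro j
    change (1 <<< (50 - n)).testBit j = true ↔ _
    rw [Nat.one_shiftLeft, Nat.testBit_two_pow, decide_eq_true_iff, eq_comm]
  obtain ⟨q, b, hb, hbmin, hq, hleaf⟩ := rulerSearch_sound hB (fun x hx => hB.lowerBound_le h25 hx)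
    n 7 _ _ (fun j => by
      change (Nat.shiftLeft 1 (50 - n) ||| 1).testBit j = true ↔ _
      rw [Nat.testBit_lor, Bool.or_eq_true, hbit, Nat.testBit_one_eq_true_iff_self_eq_zero]
      constructor
      · rintro (rfl | rfl)
        · rwa [Nat.add_sub_cancel' hn50']
        · exact hnB
      · intro hj
        have := hnmax _ hj
        omega)
    (fun k hk => by
      rw [hbit] at hk
      subst hk
      exact ⟨by omega, n, hnB, le_rfl, by rwa [Nat.add_sub_cancel' hn50']⟩)
    hcard (by simp) hsearch
  have hb' := (hmem b).1 hb
  have hx := hA' hb'.1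
  rw [table_eq] at hleaf
  refine translatesListed_sound hA' (mem_positions.2 hx) (eq_mask fun i => ?_) hleaf
  change (q <<< (b + M - 50)).testBit i = true ↔ _
  rw [Nat.testBit_shiftLeft, Bool.and_eq_true, decide_eq_true_iff, hq, hmem]
  constructor
  · rintro ⟨h1, h2, h3⟩
    rwa [show b + (i - (b + M - 50)) + M - 50 = i by omega] at h2
  · intro hi
    have h1 := hbmin (i + 50 - M) ((hmem _).2 (by
      have := hpos i hi
      rw [show i + 50 - M + M - 50 = i by omega]
      exact ⟨hi, by omega⟩))
    have := hpos i hi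
    refine ⟨by omega, ?_, by omega⟩
    rwa [show b + (i - (b + M - 50)) + M - 50 = i by omega]

theorem code_mem_nines {A : Finset ℕ} (hA : Sidon A) (hA' : A ⊆ Icc 1 51) (hc : #A = 9) :
    code A ∈ nines := by
  have hne : A.Nonempty := by
    rw [← card_pos, hc]
    norm_num
  have hM := A.max'_mem hne
  have hm := A.min'_mem hne
  have hmax : ∀ x ∈ A, x ≤ A.max' hne := fun x hx => le_max' _ _ hx
  have hmin : ∀ x ∈ A, A.min' hne ≤ x := fun x hx => min'_le _ _ hx
  generalize A.max' hne = M at hM hmax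
  generalize A.min' hne = m at hm hmin
  have hM' := mem_Icc.1 (hA' hM)
  have hm' := mem_Icc.1 (hA' hm)
  by_cases h : #{x ∈ A | x + 25 < M} ≤ 4
  · exact (code_mem_nines_of_le hA hA' hc hM hmax h).1
  have hdisj : Disjoint {x ∈ A | x + 25 < M} {x ∈ A | m + 25 < x} := by
    rw [disjoint_filter]
    intro x _ h1 h2
    omega
  have hsub : #({x ∈ A | x + 25 < M} ∪ {x ∈ A | m + 25 < x}) ≤ #A :=
    card_le_card (union_subset (filter_subset _ _) (filter_subset _ _))
  rw [card_union_of_disjoint hdisj] at hsub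
  have := (code_mem_nines_of_le (hA.reflect hA') (reflect_subset hA')
    ((card_reflect hA').trans hc) (M := 52 - m) ?_ ?_ ?_).2
  · rwa [reflect_reflect hA'] at this
  · rw [mem_reflect hA']
    rwa [show 52 - (52 - m) = m by omega]
  · intro x hx
    rw [mem_reflect hA'] at hx
    have := hmin _ hx
    have := mem_Icc.1 (hA' hx)
    omega
  · have e : {x ∈ reflect A | x + 25 < 52 - m} ⊆ reflect {x ∈ A | m + 25 < x} := by
      intro x hx
      rw [mem_filter, mem_reflect hA'] at hx
      rw [mem_reflect ((filter_subset _ _).trans hA'), mem_filter]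
      exact ⟨hx.1, by omega⟩
    have := (card_le_card e).trans (card_reflect ((filter_subset _ _).trans hA')).le
    omega

/-- The codes of all Sidon sets of eight elements in `[1,51]` of weight at least `152`, heaviest
first. -/
def heavy : List ℕ :=
  [nat_lit 730147197695623424, nat_lit 729865715232538656, nat_lit 729725116757512192,
  nat_lit 729723905178079248, nat_lit 729653603136442624, nat_lit 729602381255868928,
  nat_lit 729601839939256384, nat_lit 729600820941164552, nat_lit 729592013204238592,
  nat_lit 729584342235385888, nat_lit 727340144794796288, nat_lit 725644691203686464,
  nat_lit 725229142448538112, nat_lit 725154341227593984, nat_lit 725150528568395776,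
  nat_lit 725149996262884480, nat_lit 725149922778679304, nat_lit 725119124585644096,
  nat_lit 725116940617121920, nat_lit 725114771757860992, nat_lit 725097287147086336,
  nat_lit 725097155882255424, nat_lit 725097135699657218, nat_lit 725089160817574144,
  nat_lit 725088347944452640, nat_lit 725081945209380928, nat_lit 722832172625691648,
  nat_lit 721706242773352576, nat_lit 721279631078196224, nat_lit 721143848873246720,
  nat_lit 720875145263055872, nat_lit 720859894626263040, nat_lit 720729873354067968,
  nat_lit 720716964556968192, nat_lit 720652906866673664, nat_lit 720614423622976512,
  nat_lit 720611434660152320, nat_lit 720611131765294084, nat_lit 720594649263652896,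
  nat_lit 720580750784741504, nat_lit 720580377164388480, nat_lit 720580360706065410,
  nat_lit 720580357893652520, nat_lit 720580344348180752, nat_lit 720578158771833920,
  nat_lit 720577049575556640, nat_lit 720576541679962128, nat_lit 720576241029620744,
  nat_lit 717200456875115008, nat_lit 716776033038369792, nat_lit 716652885093401600,
  nat_lit 716636433300951040, nat_lit 716230679067885824, nat_lit 716213267756753408,
  nat_lit 716213253264378112, nat_lit 716142852320539136, nat_lit 716092133041405984,
  nat_lit 716091052313937408, nat_lit 716089954815967520, nat_lit 716085569261932800,
  nat_lit 716082786386083904, nat_lit 716081690904526880, nat_lit 716081181405480964,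
  nat_lit 716077015154819336, nat_lit 716076757598339112, nat_lit 716073646456180744,
  nat_lit 714383510270382080, nat_lit 713821644879464448, nat_lit 713821228202592256,
  nat_lit 713820824411051008, nat_lit 712694729214526976, nat_lit 712166884241645568,
  nat_lit 712136097721024768, nat_lit 711885417756492288, nat_lit 711859013295284736,
  nat_lit 711850789479916032, nat_lit 711713877209911552, nat_lit 711710631812666368,
  nat_lit 711647910282526848, nat_lit 711643509014176768, nat_lit 711639686468602368,
  nat_lit 711604213796570368, nat_lit 711603969252655680, nat_lit 711590748546941056,
  nat_lit 711587438736180256, nat_lit 711586422431679496, nat_lit 711581937447534596,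
  nat_lit 711579744835739712, nat_lit 711578095566725136, nat_lit 711578089930359312,
  nat_lit 711577548156567696, nat_lit 711574265526763522, nat_lit 711574242980139040,
  nat_lit 711573827175318592, nat_lit 711571129160962050, nat_lit 711570993902034946,
  nat_lit 711569845336145930, nat_lit 711569376880885896, nat_lit 709879904292835328,
  nat_lit 709457713965596672, nat_lit 709352134319276544, nat_lit 709319180062950400,
  nat_lit 709317560055386112, nat_lit 709317117677145088, nat_lit 708200958485102592,
  nat_lit 708192160780059136, nat_lit 707698494761075712, nat_lit 707663551264720896,
  nat_lit 707631408239419392, nat_lit 707629238207923200, nat_lit 707628849516546048,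
  nat_lit 707628651138613504, nat_lit 707628135542162176, nat_lit 707416987640398336,
  nat_lit 707364213055721472, nat_lit 707346995506856960, nat_lit 707346966522106368,
  nat_lit 707346672585285664, nat_lit 707206429296427024, nat_lit 707153171186778624,
  nat_lit 707135653586012288, nat_lit 707109156341973248, nat_lit 707105823713001984,
  nat_lit 707102564621224960, nat_lit 707102559265914944, nat_lit 707102525441987072,
  nat_lit 707100397281483008, nat_lit 707091598517215744, nat_lit 707091534143160328,
  nat_lit 707087681760272896, nat_lit 707086032765517952, nat_lit 707083970668923392,
  nat_lit 707083839670864384, nat_lit 707082939863146504, nat_lit 707082877833183872,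
  nat_lit 707076411628720384, nat_lit 707076149632602368, nat_lit 707075313598728320,
  nat_lit 707075037641916432, nat_lit 707074497278182144, nat_lit 707074490584016128,
  nat_lit 707074040680157188, nat_lit 707074009665175872, nat_lit 707073989415015552,
  nat_lit 707073975190028368, nat_lit 707073956515414146, nat_lit 707071755752179840,
  nat_lit 707071739658665986, nat_lit 707069818718261256, nat_lit 707069816573476880,
  nat_lit 707069591088662530, nat_lit 707069545013182536, nat_lit 707067479035322376,
  nat_lit 707067343481618568, nat_lit 707066541673357314, nat_lit 707066413009862928,
  nat_lit 707066245875761162, nat_lit 707065777156790280, nat_lit 707065300436254754,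
  nat_lit 707065291822338564, nat_lit 704830968255742976, nat_lit 704814716142618624,
  nat_lit 704814028946999296, nat_lit 704813893058335744, nat_lit 704813549217648896,
  nat_lit 704813413759057922, nat_lit 704813384673067010, nat_lit 703758361404903424,
  nat_lit 703757828104011776, nat_lit 703696255062770176, nat_lit 703687785408398336,
  nat_lit 703133290075324544, nat_lit 703124663639310848, nat_lit 703124501761622288,
  nat_lit 702913387219255808, nat_lit 702860612275273736, nat_lit 702843588144318464,
  nat_lit 702843042788278816, nat_lit 702843038892294528, nat_lit 702737464941412608,
  nat_lit 702712175243841536, nat_lit 702711077649074176, nat_lit 702711076693475344,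
  nat_lit 702706680630153728, nat_lit 702702565007057920, nat_lit 702649520116281344,
  nat_lit 702649503207161984, nat_lit 702636858556819456, nat_lit 702636377407291520,
  nat_lit 702614327161782288, nat_lit 702606622396007424, nat_lit 702603324406497536,
  nat_lit 702599200213308416, nat_lit 702598938217190400, nat_lit 702596933541188096,
  nat_lit 702596881984782656, nat_lit 702596801942782472, nat_lit 702596797914219584,
  nat_lit 702583558140666368, nat_lit 702581886072918272, nat_lit 702580233842206976,
  nat_lit 702580233722757122, nat_lit 702579209255518368, nat_lit 702579169761954944,
  nat_lit 702571712423755904, nat_lit 702571507273958432, nat_lit 702570956455675136,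
  nat_lit 702570552979783688, nat_lit 702570382523367940, nat_lit 702570376898543696,
  nat_lit 702567177416351746, nat_lit 702567176935573632, nat_lit 702567045937514624,
  nat_lit 702566764686884896, nat_lit 702566216413221504, nat_lit 702566103259365380,
  nat_lit 702565962196582658, nat_lit 702564293903656000, nat_lit 702564153278341136,
  nat_lit 702564084895187488, nat_lit 702563822564581378, nat_lit 702563794647273474,
  nat_lit 702563262038016320, nat_lit 702562917886726688, nat_lit 702562642862022724,
  nat_lit 702561859747971140, nat_lit 700591355298058240, nat_lit 700380119608397824,
  nat_lit 700344927648753664, nat_lit 700314157288292864, nat_lit 700310842652360712,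
  nat_lit 700310568839581696, nat_lit 700309781809726528, nat_lit 699465326815348736,
  nat_lit 699465323640260608, nat_lit 699201438653481216, nat_lit 699184185781453824,
  nat_lit 699184066594898048, nat_lit 699183862026076704, nat_lit 698656081537138752,
  nat_lit 698656078769963520, nat_lit 698638553137807872, nat_lit 698622005666386048,
  nat_lit 698621592292303872, nat_lit 698621064011727360, nat_lit 698621004418662464,
  nat_lit 698620946424008706, nat_lit 698620944079389760, nat_lit 698374618792460800,
  nat_lit 698343816345190464, nat_lit 698341075613552640, nat_lit 698339986303095040,
  nat_lit 698339971273228416, nat_lit 698339573180407840, nat_lit 698339503127183616,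
  nat_lit 698207613317415168, nat_lit 698207477445165060, nat_lit 698199246687731728,
  nat_lit 698139306674095104, nat_lit 698132788490541056, nat_lit 698132734937212928,
  nat_lit 698132732688994432, nat_lit 698132709843795970, nat_lit 698132709654265864,
  nat_lit 698130510285113472, nat_lit 698128725585208320, nat_lit 698128586142056456,
  nat_lit 698128462388397072, nat_lit 698128317472047240, nat_lit 698110856282522624,
  nat_lit 698096425420198912, nat_lit 698095337465710656, nat_lit 698094243311783944,
  nat_lit 698094236326757632, nat_lit 698094226263770176, nat_lit 698093304856715280,
  nat_lit 698093264192241668, nat_lit 698080001207570560, nat_lit 698076659712270352,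
  nat_lit 698075964462399504, nat_lit 698075572278919428, nat_lit 698075570264637984,
  nat_lit 698067065021562888, nat_lit 698067014691848328, nat_lit 698066889733309442,
  nat_lit 698066791217496208, nat_lit 698066766387020040, nat_lit 698063459144702080,
  nat_lit 698063027519406144, nat_lit 698062890314801160, nat_lit 698062620132934016,
  nat_lit 698062447797420036, nat_lit 698062366201350720, nat_lit 698061249369932864,
  nat_lit 698060759775315008, nat_lit 698060692669857922, nat_lit 698060150999613460,
  nat_lit 698060150665642004, nat_lit 698059215702351874, nat_lit 698059213561671696,
  nat_lit 698059110843154498, nat_lit 698059043121430546, nat_lit 695876512851298304,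
  nat_lit 695810712811225088, nat_lit 695810695100401664, nat_lit 695810541821663232,
  nat_lit 695810541617197056, nat_lit 695808478910361600, nat_lit 695808358638485632,
  nat_lit 695807516887025664, nat_lit 695806727104233474, nat_lit 695806692823400452,
  nat_lit 695806282837270536, nat_lit 695806280556610304, nat_lit 695806153569341444,
  nat_lit 695806147932459012, nat_lit 695806145926930434, nat_lit 694820986588234752,
  nat_lit 694750621204480128, nat_lit 694715431298041856, nat_lit 694715427733177344,
  nat_lit 694697835318219776, nat_lit 694682527713140736, nat_lit 694681891810608128,
  nat_lit 694681410762708992, nat_lit 694681367842127874, nat_lit 694681350676414466,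
  nat_lit 694680929751041024, nat_lit 694680264206458882, nat_lit 694258168586928128,
  nat_lit 694187695715124224, nat_lit 694187664601645568, nat_lit 694134897656481792,
  nat_lit 694121763630875136, nat_lit 694118538117649408, nat_lit 694118430736392704,
  nat_lit 694117842620022786, nat_lit 694117516443914496, nat_lit 694117447254610944,
  nat_lit 693871003608350976, nat_lit 693862208564633600, nat_lit 693853410878824704,
  nat_lit 693836247092855296, nat_lit 693730401994277888, nat_lit 693730265562092032,
  nat_lit 693730265289785600, nat_lit 693703876746940544, nat_lit 693699518952379392,
  nat_lit 693697846067331328, nat_lit 693696197869011072, nat_lit 693695091126304960,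
  nat_lit 693659913199026208, nat_lit 693637907688456704, nat_lit 693626930783717888,
  nat_lit 693626094341193856, nat_lit 693625279385447424, nat_lit 693598331738298368,
  nat_lit 693590632412742176, nat_lit 693589750329905184, nat_lit 693589616107980802,
  nat_lit 693589580674781248, nat_lit 693589530229866564, nat_lit 693580735499501570,
  nat_lit 693574683722973440, nat_lit 693573051501346824, nat_lit 693572487513899280,
  nat_lit 693572038450751744, nat_lit 693572020847247504, nat_lit 693572012672549024,
  nat_lit 693571961644918816, nat_lit 693565372097628224, nat_lit 693564257014382752,
  nat_lit 693563701349978120, nat_lit 693563311580823568, nat_lit 693563194543768584,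
  nat_lit 693563181731151944, nat_lit 693563156561135168, nat_lit 693561489713537088,
  nat_lit 693559943319814152, nat_lit 693559857890496520, nat_lit 693559857356342304,
  nat_lit 693559843469918468, nat_lit 693558904004583428, nat_lit 693558896622579716,
  nat_lit 693558826720297092, nat_lit 693558776699060384, nat_lit 693558767102591048,
  nat_lit 693558762173104164, nat_lit 693557782951494272, nat_lit 693557779683607554,
  nat_lit 693557663161716740, nat_lit 693556833966096648, nat_lit 693556682298786818,
  nat_lit 693556679816511620, nat_lit 693556623309819906, nat_lit 693556584667676738,
  nat_lit 693556133687723010, nat_lit 693556002888386562, nat_lit 693554995467192324,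
  nat_lit 693554897213195024, nat_lit 693554669041124354, nat_lit 693554557636083752,
  nat_lit 691865510140256256, nat_lit 691865497595807744, nat_lit 691865496014029056,
  nat_lit 691584155387957248, nat_lit 691584030934042624, nat_lit 691443300166533376,
  nat_lit 691372920190271744, nat_lit 691320152210800768, nat_lit 691320135550505984,
  nat_lit 691311356080062976, nat_lit 691307129830707200, nat_lit 691305978810077184,
  nat_lit 691305849928617984, nat_lit 691304760078599168, nat_lit 691304743007551496,
  nat_lit 691303790491533568, nat_lit 691303685296304128, nat_lit 691302681382617092,
  nat_lit 691302579311019520, nat_lit 691302548270780424, nat_lit 690317449515501568,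
  nat_lit 690211853070536704, nat_lit 690185585019323392, nat_lit 690185447599243328,
  nat_lit 690181178550124672, nat_lit 690181043374522376, nat_lit 690178936409196544,
  nat_lit 690178159026442240, nat_lit 690178017296941568, nat_lit 690177742997618692,
  nat_lit 690177330124096512, nat_lit 690177214141995008, nat_lit 690176713098792964,
  nat_lit 690176698800439298, nat_lit 690176670847468552, nat_lit 689754980504571904,
  nat_lit 689631287288332352, nat_lit 689631285546746368, nat_lit 689623589632344192,
  nat_lit 689622489339267584, nat_lit 689618095293464608, nat_lit 689618093272203268,
  nat_lit 689615977867980800, nat_lit 689614964255889408, nat_lit 689614930098257922,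
  nat_lit 689614551943283712, nat_lit 689614036555891200, nat_lit 689613899636974592,
  nat_lit 689613728043239426, nat_lit 689613718998221828, nat_lit 689613718882877712,
  nat_lit 689613704786084112, nat_lit 689402861746128896, nat_lit 689402655973621760,
  nat_lit 689350085137662464, nat_lit 689349827471343624, nat_lit 689349812635041824,
  nat_lit 689349811392741384, nat_lit 689341020508398592, nat_lit 689332497808408704,
  nat_lit 689332360776263168, nat_lit 689262399148068864, nat_lit 689209090916488192,
  nat_lit 689200435483914240, nat_lit 689200328377257984, nat_lit 689196995219030272,
  nat_lit 689193129915514944, nat_lit 689192616528467968, nat_lit 689191534701052936,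
  nat_lit 689191493446926608, nat_lit 689138704523493504, nat_lit 689121412530569856,
  nat_lit 689121186359017736, nat_lit 689121181692866592, nat_lit 689121138844369412,
  nat_lit 689094775529423872, nat_lit 689094723755589696, nat_lit 689091431393927680,
  nat_lit 689086339719643152, nat_lit 689086211372881408, nat_lit 689086077759127872,
  nat_lit 689085946854933508, nat_lit 689085946154455560, nat_lit 689085940916027650,
  nat_lit 689072737549306880, nat_lit 689068406043348994, nat_lit 689068362017543200,
  nat_lit 689068353830518850, nat_lit 689068353567850506, nat_lit 689068336795090978,
  nat_lit 689065037184647296, nat_lit 689064504333437440, nat_lit 689064487962050576,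
  nat_lit 689064025176276994, nat_lit 689061744697410056, nat_lit 689061740268496384,
  nat_lit 689060088973890688, nat_lit 689059754097590280, nat_lit 689059711198167304,
  nat_lit 689059695310163972, nat_lit 689059690478567938, nat_lit 689059556998791440,
  nat_lit 689057623660561664, nat_lit 689056266320085280, nat_lit 689056245654487298,
  nat_lit 689055836827385864, nat_lit 689055725689766416, nat_lit 689055450280624768,
  nat_lit 689055364376954882, nat_lit 689055248542638084, nat_lit 689055227470569480,
  nat_lit 689055168952041988, nat_lit 689054316536926240, nat_lit 689054179231277060,
  nat_lit 689054059776348168, nat_lit 689053081598232580, nat_lit 689052968327053322,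
  nat_lit 689052960029687888, nat_lit 689052952766709778, nat_lit 689052944745693220,
  nat_lit 689052462048675848, nat_lit 689052461109481474, nat_lit 689052396551438880,
  nat_lit 689052151754129952, nat_lit 689051988663206020, nat_lit 689051930546673666,
  nat_lit 689051912460312672, nat_lit 689051912292959234, nat_lit 689051911756763140,
  nat_lit 689051864108406786, nat_lit 689051851508686888, nat_lit 689051849109569554,
  nat_lit 689051362637643786, nat_lit 689051173029740624, nat_lit 687362447247802368,
  nat_lit 687361910612427264, nat_lit 687361910380728320, nat_lit 687361902800274432,
  nat_lit 687080420847911168, nat_lit 686939698245214208, nat_lit 686816827423590400,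
  nat_lit 686807741451468816, nat_lit 686803414235809792, nat_lit 686802241751418880,
  nat_lit 686801159483031556, nat_lit 686801151861336064, nat_lit 686800046041112832,
  nat_lit 686799496184631552, nat_lit 686799364083160064, nat_lit 686799286788980992,
  nat_lit 686799220476870658, nat_lit 686799114989879808, nat_lit 686799029090421760,
  nat_lit 686798986679435266, nat_lit 686798986543120388, nat_lit 686798970026198032,
  nat_lit 686798964701266440, nat_lit 686798963050807568, nat_lit 686798960773824832,
  nat_lit 686798946135248900, nat_lit 685708365151077376, nat_lit 685681843929350152,
  nat_lit 685674229217104384, nat_lit 685674212062396418, nat_lit 685673667112239232,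
  nat_lit 685673456658892800, nat_lit 685673352639424512, nat_lit 685673318464487426,
  nat_lit 685673185003571712, nat_lit 685673147034241152, nat_lit 685673095381387272,
  nat_lit 685673048837457922, nat_lit 685250839430049792, nat_lit 685180479289426048,
  nat_lit 685162875259469824, nat_lit 685145827660268544, nat_lit 685145284171268112,
  nat_lit 685118891958206466, nat_lit 685116691071631616, nat_lit 685114706112827392,
  nat_lit 685114491501020416, nat_lit 685112293553733636, nat_lit 685111211079188992,
  nat_lit 685110666692921472, nat_lit 685110662401133056, nat_lit 685110436928307712,
  nat_lit 685110405236277312, nat_lit 685110378937469952, nat_lit 685110369299046912,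
  nat_lit 685110107290206724, nat_lit 684872601086988288, nat_lit 684846212144431106,
  nat_lit 684837448808005888, nat_lit 684837415510638624, nat_lit 684833034105257986,
  nat_lit 684830821658558592, nat_lit 684829760800462848, nat_lit 684829752250925088,
  nat_lit 684829735569601024, nat_lit 684828704244965632, nat_lit 684828642095661570,
  nat_lit 684828623306227848, nat_lit 684723099853283328, nat_lit 684709872223651840,
  nat_lit 684688710045878272, nat_lit 684688095599214848, nat_lit 684688030102979088,
  nat_lit 684687958829305872, nat_lit 684652971440506880, nat_lit 684637304412735488,
  nat_lit 684635208443791360, nat_lit 684635113199501314, nat_lit 684626312497823872,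
  nat_lit 684621910426257472, nat_lit 684619722955686976, nat_lit 684619712740493568,
  nat_lit 684617795582967816, nat_lit 684617619479765120, nat_lit 684591261290602752,
  nat_lit 684584531054043144, nat_lit 684584527066234884, nat_lit 684583979684270592,
  nat_lit 684583019223384128, nat_lit 684582539260592704, nat_lit 684582505974597648,
  nat_lit 684582469471641604, nat_lit 684582349610156104, nat_lit 684575731754238208,
  nat_lit 684574666051818496, nat_lit 684569154027521032, nat_lit 684567074168637504,
  nat_lit 684565972637458434, nat_lit 684565422780977154, nat_lit 684565388918587408,
  nat_lit 684565290402480768, nat_lit 684565081291849760, nat_lit 684564899023634434,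
  nat_lit 684564877552913152, nat_lit 684564791649501712, nat_lit 684564754347327506,
  nat_lit 684564753036610568, nat_lit 684558276991655944, nat_lit 684558192164765700,
  nat_lit 684557589803175952, nat_lit 684557107694940288, nat_lit 684557041121169412,
  nat_lit 684556695506010120, nat_lit 684556317414920200, nat_lit 684556266139451394,
  nat_lit 684556266139369480, nat_lit 684555946047045642, nat_lit 684554015847497736,
  nat_lit 684553895317667842, nat_lit 684552660246380546, nat_lit 684552642000720640,
  nat_lit 684551567718219786, nat_lit 684551555432611972, nat_lit 684551550365868168,
  nat_lit 684550581482295312, nat_lit 684549943712694276, nat_lit 684549943683713026,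
  nat_lit 684549690280165380, nat_lit 684549685998805024, nat_lit 684549497006784832,
  nat_lit 684549482305568960, nat_lit 684549480632027456, nat_lit 684549436873966594,
  nat_lit 684549420364077058, nat_lit 684549356342493442, nat_lit 684549355339777312,
  nat_lit 684548811016110120, nat_lit 684548518824215560, nat_lit 684548383599493130,
  nat_lit 684548249350046352, nat_lit 684548003444424864, nat_lit 684547779066069026,
  nat_lit 684547420659384712, nat_lit 684547197115572234]

/-- The table without its first entries. -/
def Table.drop : ℕ → Table → Table
  | 0, t => t
  | _ + 1, .nil => .nil
  | n + 1, .cons _ _ _ _ _ t => t.drop n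

theorem Table.drop_ofList (n : ℕ) (l : List ℕ) : (ofList l).drop n = ofList (l.drop n) := by
  induction l generalizing n with
  | nil => cases n <;> rfl
  | cons x l ih =>
    cases n
    · rfl
    · exact ih _

/-- The search for the heavy sets of eight elements with first element at a given index. -/
noncomputable def heavySearchFrom (i : ℕ) : Bool :=
  Table.rec true
    (fun _ _ bx bY w t _ =>
      heavySearch
        (fun s w =>
          Bool.rec (elem (Nat.add s (Nat.mul w (nat_lit 4503599627370496))) heavy) true
            (Nat.ble w (nat_lit 151)))
        t (nat_lit 7) bx bY (nat_lit 0) w)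
    (table.drop i)

theorem heavySearchFrom_zero : heavySearchFrom 0 = true := by
  decide +kernel

theorem heavySearchFrom_one : heavySearchFrom 1 = true := by
  decide +kernel

theorem heavySearchFrom_two : heavySearchFrom 2 = true := by
  decide +kernel

theorem heavySearchFrom_lt_five : ∀ i < 2, heavySearchFrom (3 + i) = true := by
  decide +kernel

theorem heavySearchFrom_lt_eight : ∀ i < 3, heavySearchFrom (5 + i) = true := by
  decide +kernel

theorem heavySearchFrom_lt_fifty_one : ∀ i < 43, heavySearchFrom (8 + i) = true := by
  decide +kernel

theorem heavySearchFrom_eq_true {i : ℕ} (h : i < 51) : heavySearchFrom i = true := by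
  rcases lt_or_ge i 8 with h8 | h8
  · rcases lt_or_ge i 5 with h5 | h5
    · rcases lt_or_ge i 3 with h3 | h3
      · interval_cases i
        exacts [heavySearchFrom_zero, heavySearchFrom_one, heavySearchFrom_two]
      · have := heavySearchFrom_lt_five (i - 3) (by omega)
        rwa [Nat.add_sub_cancel' h3] at this
    · have := heavySearchFrom_lt_eight (i - 5) (by omega)
      rwa [Nat.add_sub_cancel' h5] at this
  · have := heavySearchFrom_lt_fifty_one (i - 8) (by omega)
    rwa [Nat.add_sub_cancel' h8] at this

theorem code_mem_heavy {B : Finset ℕ} (hB : Sidon B) (hB' : B ⊆ Icc 1 51) (hc : #B = 8)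
    (hw : 152 ≤ ∑ x ∈ B, weight x) : code B ∈ heavy := by
  have hex : ∃ i, ∃ h : i < positions.length, positions[i] ∈ B := by
    obtain ⟨x, hx⟩ : B.Nonempty := by
      rw [← card_pos, hc]
      norm_num
    obtain ⟨i, hi, e⟩ := List.mem_iff_getElem.1 (mem_positions.2 (hB' hx))
    exact ⟨i, hi, e ▸ hx⟩
  classical
  obtain ⟨hi, hx⟩ := Nat.find_spec hex
  have hmin := fun j => Nat.find_min hex (m := j)
  generalize Nat.find hex = i at hi hx hmin
  set x := positions[i] with hxdef
  have hdrop : positions.drop i = x :: positions.drop (i + 1) := List.drop_eq_getElem_cons hi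
  have hsub : List.Sublist (positions.drop i) positions := List.drop_sublist _ _
  have hnd := hsub.nodup nodup_positions
  have hpw := pairwise_positions.sublist hsub
  rw [hdrop] at hnd hpw
  have hcover : ∀ y ∈ B, y ∉ ({x} : Finset ℕ) → y ∈ positions.drop (i + 1) := by
    intro y hy hyx
    have hy' := mem_positions.2 (hB' hy)
    rw [← List.take_append_drop i positions, List.mem_append, hdrop, List.mem_cons] at hy'
    rcases hy' with h | h | h
    · obtain ⟨j, hj, rfl⟩ := List.mem_iff_getElem.1 h
      rw [List.length_take] at hj
      rw [List.getElem_take] at hy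
      exact absurd ⟨by omega, hy⟩ (hmin j (by omega))
    · exact absurd (mem_singleton.2 h) hyx
    · exact h
  have hs := heavySearchFrom_eq_true (i := i) hi
  rw [heavySearchFrom, table_eq, Table.drop_ofList, hdrop] at hs
  have ht := tracks_empty.insert (empty_subset _) (hB' hx) (notMem_empty x)
  have := heavySearch_sound hB hB' hw _ (List.nodup_cons.1 hnd).2 (List.pairwise_cons.1 hpw).2
    {x} 7 (2 ^ x) (2 ^ (52 - x)) 0 (by simpa using ht) (singleton_subset_iff.2 hx) hcover
    (by
      intro y hy
      rw [mem_singleton.1 hy]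
      exact (List.nodup_cons.1 hnd).1)
    (by rw [card_sdiff_of_subset (singleton_subset_iff.2 hx), hc, card_singleton])
    (by
      rw [sum_singleton]
      exact hs)
  have hf : Nat.ble (∑ x ∈ B, weight x) 151 = false := by
    rw [← Bool.not_eq_true, Nat.ble_eq]
    omega
  rw [hf] at this
  rw [code_eq]
  exact mem_of_elem this

/-- Conjunction with lazy second argument. -/
noncomputable def both (p q : Bool) : Bool :=
  Bool.rec false q p

theorem of_both {p q : Bool} (h : both p q = true) : p = true ∧ q = true := by
  cases p
  · cases h
  · exact ⟨rfl, h⟩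

/-- The entries of a table that belong to the set coded by `u`. -/
noncomputable def restrict (u : ℕ) (t : Table) : Table :=
  Table.rec .nil
    (fun x y bx bY w _ ih =>
      Bool.rec (.cons x y bx bY w ih) ih (Nat.beq (Nat.land u bx) (nat_lit 0)))
    t

theorem restrict_ofList {A : Finset ℕ} (hA : A ⊆ Icc 1 51) (l : List ℕ) (hl : ∀ x ∈ l, x < 52) :
    restrict (code A) (Table.ofList l) = Table.ofList (l.filter (· ∈ A)) := by
  induction l with
  | nil => rfl
  | cons x l ih =>
    have hb : Nat.beq (Nat.land (code A) (2 ^ x)) 0 = decide (x ∉ A) := by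
      rw [Bool.eq_iff_iff, Nat.beq_eq, decide_eq_true_iff,
        ← testBit_code hA (hl x List.mem_cons_self)]
      change code A &&& 2 ^ x = 0 ↔ _
      rw [Nat.and_two_pow]
      cases (code A).testBit x <;> simp
    change (Bool.rec (.cons _ _ _ _ _ (restrict (code A) (Table.ofList l)))
      (restrict (code A) (Table.ofList l)) (Nat.beq (Nat.land (code A) (2 ^ x)) 0) : Table) = _
    rw [hb, ih fun y hy => hl y (List.mem_cons_of_mem _ hy)]
    by_cases hx : x ∈ A
    · simp only [hx, not_true_eq_false, decide_false, List.filter_cons, decide_true, if_true]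
      rfl
    · simp [hx]

/-- The search for all ways to distribute the entries of a table over two Sidon sets; it succeeds if
there are none. -/
noncomputable def splitSearch (t : Table) : ℕ → ℕ → ℕ → ℕ → ℕ → ℕ → Bool :=
  Table.rec (fun _ _ _ _ _ _ => false)
    (fun x y bx bY _ _ ih s v d s' v' d' =>
      both
        ((fun c =>
            Bool.rec true (ih (Nat.lor s bx) (Nat.lor v bY) (Nat.lor d c) s' v' d')
              (Nat.beq (Nat.lor (Nat.land (Nat.shiftRight s x) (Nat.shiftRight v y)) (Nat.land d c))
                (nat_lit 0)))
          (Nat.lor (Nat.shiftRight s x) (Nat.shiftRight v y)))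
        ((fun c =>
            Bool.rec true (ih s v d (Nat.lor s' bx) (Nat.lor v' bY) (Nat.lor d' c))
              (Nat.beq
                (Nat.lor (Nat.land (Nat.shiftRight s' x) (Nat.shiftRight v' y)) (Nat.land d' c))
                (nat_lit 0)))
          (Nat.lor (Nat.shiftRight s' x) (Nat.shiftRight v' y))))
    t

theorem splitSearch_sound {B B' : Finset ℕ} (hB : Sidon B) (hB' : Sidon B') (h51 : B ⊆ Icc 1 51)
    (h51' : B' ⊆ Icc 1 51) (l : List ℕ) (hl : l.Nodup) (hmem : ∀ x ∈ l, x ∈ B ∨ x ∈ B') :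
    ∀ (A A' : Finset ℕ) (s v d s' v' d' : ℕ), Tracks A s v d → Tracks A' s' v' d' → A ⊆ B →
      A' ⊆ B' → (∀ x ∈ l, x ∉ A ∧ x ∉ A') →
      splitSearch (Table.ofList l) s v d s' v' d' ≠ true := by
  induction l with
  | nil =>
    intro A A' s v d s' v' d' _ _ _ _ _ h
    cases h
  | cons x l ih =>
    intro A A' s v d s' v' d' ht ht' hA hA' hx h
    rw [List.nodup_cons] at hl
    obtain ⟨h1, h2⟩ := of_both h
    have key : ∀ {p : Bool} {n : ℕ}, (Bool.rec true p (Nat.beq n 0) : Bool) = true → n = 0 →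
        p = true := by
      rintro p n h rfl
      exact h
    obtain ⟨hxA, hxA'⟩ := hx x List.mem_cons_self
    have hne : ∀ y ∈ l, y ≠ x := fun y hy e => hl.1 (e ▸ hy)
    have hx' := fun y hy => hx y (List.mem_cons_of_mem x hy)
    rcases hmem x List.mem_cons_self with hxB | hxB
    · refine ih hl.2 (fun y hy => hmem y (List.mem_cons_of_mem _ hy)) (insert x A) A' _ _ _ _ _ _
        (ht.insert (hA.trans h51) (h51 hxB) hxA) ht' (insert_subset hxB hA) hA' (fun y hy => ?_)
        (key h1 (ht.compatible hA hB h51 hxB hxA))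
      exact ⟨by simp [hne y hy, (hx' y hy).1], (hx' y hy).2⟩
    · refine ih hl.2 (fun y hy => hmem y (List.mem_cons_of_mem _ hy)) A (insert x A') _ _ _ _ _ _
        ht (ht'.insert (hA'.trans h51') (h51' hxB) hxA') hA (insert_subset hxB hA') (fun y hy => ?_)
        (key h2 (ht'.compatible hA' hB' h51' hxB hxA'))
      exact ⟨(hx' y hy).1, by simp [hne y hy, (hx' y hy).2]⟩

/-- The test that the set coded by `u` is not the union of two Sidon sets. -/
noncomputable def unsplit (u : ℕ) : Bool :=
  Table.rec false (fun _ _ bx bY _ t _ => splitSearch t bx bY 0 0 0 0) (restrict u table)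

theorem unsplit_sound {A B : Finset ℕ} (hA : Sidon A) (hB : Sidon B) (hA' : A ⊆ Icc 1 51)
    (hB' : B ⊆ Icc 1 51) : unsplit (code (A ∪ B)) ≠ true := by
  have hlt : ∀ x ∈ positions, x < 52 := by
    intro x hx
    have := mem_Icc.1 (mem_positions.1 hx)
    omega
  have hmem : ∀ x ∈ positions.filter (· ∈ A ∪ B), x ∈ A ∨ x ∈ B := by
    intro x hx
    simpa using (List.mem_filter.1 hx).2
  have hnd : (positions.filter (· ∈ A ∪ B)).Nodup := nodup_positions.filter _
  rw [unsplit, table_eq, restrict_ofList (union_subset hA' hB') _ hlt]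
  generalize positions.filter (· ∈ A ∪ B) = l at hmem hnd
  obtain _ | ⟨x, l⟩ := l
  · exact Bool.false_ne_true
  have hxl := (List.nodup_cons.1 hnd).1
  have base : ∀ {A B : Finset ℕ}, Sidon A → Sidon B → A ⊆ Icc 1 51 → B ⊆ Icc 1 51 →
      (∀ y ∈ l, y ∈ A ∨ y ∈ B) → x ∈ A →
      splitSearch (Table.ofList l) (2 ^ x) (2 ^ (52 - x)) 0 0 0 0 ≠ true := by
    intro A B hA hB hA' hB' hmem hx
    have ht := tracks_empty.insert (empty_subset _) (hA' hx) (notMem_empty x)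
    refine splitSearch_sound hA hB hA' hB' l (List.nodup_cons.1 hnd).2 hmem {x} ∅ _ _ _ _ _ _
      (by simpa using ht) tracks_empty (singleton_subset_iff.2 hx) (empty_subset _) fun y hy => ?_
    simp only [mem_singleton, notMem_empty, not_false_eq_true, and_true]
    rintro rfl
    exact hxl hy
  rcases hmem x List.mem_cons_self with hx | hx
  · exact base hA hB hA' hB' (fun y hy => hmem y (List.mem_cons_of_mem _ hy)) hx
  · exact base hB hA hB' hA' (fun y hy => (hmem y (List.mem_cons_of_mem _ hy)).symm) hx

/-- The test that no heavy set inside the set coded by `r`, of at least a third of its weight, has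
a complement that is a union of two Sidon sets; `l` lists the heavy sets. -/
noncomputable def unsplitBelow (r : ℕ) (l : List ℕ) : Bool :=
  List.rec true
    (fun s _ ih =>
      Bool.rec true
        (Bool.rec ih (both (unsplit (Nat.sub r s)) ih)
          (Nat.beq (Nat.land (Nat.mod s (nat_lit 4503599627370496)) r)
            (Nat.mod s (nat_lit 4503599627370496))))
        (Nat.ble (Nat.div r (nat_lit 4503599627370496))
          (Nat.mul (nat_lit 3) (Nat.div s (nat_lit 4503599627370496)))))
    l

theorem unsplitBelow_sound {r s : ℕ} {l : List ℕ}
    (hl : l.Pairwise fun s t => t / 2 ^ 52 ≤ s / 2 ^ 52) (hs : s ∈ l)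
    (hw : r / 2 ^ 52 ≤ 3 * (s / 2 ^ 52)) (hr : Nat.land (s % 2 ^ 52) r = s % 2 ^ 52)
    (h : unsplitBelow r l = true) : unsplit (r - s) = true := by
  induction l with
  | nil => cases hs
  | cons a l ih =>
    rw [List.pairwise_cons] at hl
    change (Bool.rec true (Bool.rec (unsplitBelow r l) (both (unsplit (r - a)) (unsplitBelow r l))
      (Nat.beq (Nat.land (a % 2 ^ 52) r) (a % 2 ^ 52)))
      (Nat.ble (r / 2 ^ 52) (3 * (a / 2 ^ 52))) : Bool) = true at h
    have ha : Nat.ble (r / 2 ^ 52) (3 * (a / 2 ^ 52)) = true := by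
      rw [Nat.ble_eq]
      rcases List.mem_cons.1 hs with rfl | hs
      · exact hw
      · exact hw.trans (Nat.mul_le_mul_left 3 (hl.1 s hs))
    rw [ha] at h
    rcases List.mem_cons.1 hs with rfl | hs
    · rw [show Nat.beq _ _ = true from Nat.beq_eq ▸ hr] at h
      exact (of_both h).1
    · refine ih hl.2 hs ?_
      revert h
      cases Nat.beq (Nat.land (a % 2 ^ 52) r) (a % 2 ^ 52)
      · exact id
      · exact fun h => (of_both h).2

theorem pairwise_heavy : heavy.Pairwise fun s t => t / 2 ^ 52 ≤ s / 2 ^ 52 := by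
  have h : heavy.IsChain fun s t => t ≤ s := by
    decide +kernel
  exact (List.isChain_iff_pairwise.1 h).imp fun h => Nat.div_le_div_right h

/-- The test that the set coded by `r` is not the union of three Sidon sets of eight elements. -/
noncomputable def untriple (r : ℕ) : Bool :=
  both (Nat.ble (nat_lit 454) (Nat.div r (nat_lit 4503599627370496))) (unsplitBelow r heavy)

theorem untriple_sound {A : Fin 3 → Finset ℕ} (hA : ∀ i, Sidon (A i)) (hA' : ∀ i, A i ⊆ Icc 1 51)
    (hd : ∀ i j, i ≠ j → Disjoint (A i) (A j)) (hc : ∀ i, #(A i) = 8) :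
    untriple (code (A 0) + code (A 1) + code (A 2)) ≠ true := by
  intro h
  have key : ∀ i j k, i ≠ j → i ≠ k → j ≠ k →
      code (A 0) + code (A 1) + code (A 2) = code (A i) + code (A j) + code (A k) →
      ∑ x ∈ A j, weight x ≤ ∑ x ∈ A i, weight x → ∑ x ∈ A k, weight x ≤ ∑ x ∈ A i, weight x →
      False := by
    intro i j k hij hik hjk e hwj hwk
    have hjk' : A j ∪ A k ⊆ Icc 1 51 := union_subset (hA' j) (hA' k)
    have hd' : Disjoint (A i) (A j ∪ A k) := disjoint_union_right.2 ⟨hd i j hij, hd i k hik⟩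
    have hU : A i ∪ (A j ∪ A k) ⊆ Icc 1 51 := union_subset (hA' i) hjk'
    have e' : code (A i) + code (A j) + code (A k) = code (A i ∪ (A j ∪ A k)) := by
      rw [code_union hd', code_union (hd j k hjk), add_assoc]
    rw [e, e'] at h
    obtain ⟨h1, h2⟩ := of_both h
    rw [Nat.ble_eq] at h1
    change 454 ≤ code (A i ∪ (A j ∪ A k)) / 2 ^ 52 at h1
    rw [code_div hU, sum_union hd', sum_union (hd j k hjk)] at h1
    have := unsplitBelow_sound pairwise_heavy
      (code_mem_heavy (hA i) (hA' i) (hc i) (by omega))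
      (by
        rw [code_div hU, code_div (hA' i), sum_union hd', sum_union (hd j k hjk)]
        omega)
      (by rw [code_mod (hA' i), land_mask_code (hA' i) hU, inter_eq_left.2 subset_union_left]) h2
    rw [code_union hd', Nat.add_sub_cancel_left] at this
    exact unsplit_sound (hA j) (hA k) (hA' j) (hA' k) this
  rcases le_total (∑ x ∈ A 0, weight x) (∑ x ∈ A 1, weight x) with h1 | h1
  · rcases le_total (∑ x ∈ A 1, weight x) (∑ x ∈ A 2, weight x) with h2 | h2
    · exact key 2 0 1 (by decide) (by decide) (by decide) (by ring) (h1.trans h2) h2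
    · exact key 1 0 2 (by decide) (by decide) (by decide) (by ring) h1 h2
  · rcases le_total (∑ x ∈ A 0, weight x) (∑ x ∈ A 2, weight x) with h2 | h2
    · exact key 2 0 1 (by decide) (by decide) (by decide) (by ring) h2 (h1.trans h2)
    · exact key 0 1 2 (by decide) (by decide) (by decide) rfl h1 h2

/-- The codes in a list of sets disjoint from the set with bitmask `m`. -/
noncomputable def disjointFrom (m : ℕ) (l : List ℕ) : List ℕ :=
  List.rec [] (fun c _ ih => Bool.rec ih (c :: ih) (Nat.beq (Nat.land m c) (nat_lit 0))) l

theorem sublist_disjointFrom {m : ℕ} {s l : List ℕ} (h : List.Sublist s l)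
    (hs : ∀ c ∈ s, Nat.land m c = 0) : List.Sublist s (disjointFrom m l) := by
  have step : ∀ c l, disjointFrom m (c :: l) =
      Bool.rec (disjointFrom m l) (c :: disjointFrom m l) (Nat.beq (Nat.land m c) 0) :=
    fun _ _ => rfl
  induction h with
  | slnil => exact List.Sublist.refl _
  | cons c _ ih =>
    rw [step]
    cases Nat.beq (Nat.land m c) 0
    · exact ih hs
    · exact (ih hs).cons c
  | cons_cons c _ ih =>
    rw [step, hs c List.mem_cons_self]
    exact (ih fun y hy => hs y (List.mem_cons_of_mem _ hy)).cons_cons c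

/-- The test that a function is true at each entry of a list together with the entries after it. -/
noncomputable def everyTail (f : ℕ → List ℕ → Bool) (l : List ℕ) : Bool :=
  List.rec true (fun a t ih => both (f a t) ih) l

theorem everyTail_sound {f : ℕ → List ℕ → Bool} {a : ℕ} {s l : List ℕ}
    (hs : List.Sublist (a :: s) l) (h : everyTail f l = true) :
    ∃ t, List.Sublist s t ∧ f a t = true := by
  induction l with
  | nil => cases hs
  | cons b l ih =>
    obtain ⟨h1, h2⟩ := of_both h
    cases hs with
    | cons _ hs => exact ih hs h2
    | cons_cons _ hs => exact ⟨l, hs, h1⟩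

/-- The same test for the first `n` entries. -/
noncomputable def firstTails (f : ℕ → List ℕ → Bool) (l : List ℕ) : ℕ → Bool :=
  List.rec (fun _ => true) (fun a t ih n => Nat.rec true (fun n _ => both (f a t) (ih n)) n) l

theorem firstTails_sound {f : ℕ → List ℕ → Bool} {a : ℕ} {s l : List ℕ}
    (hs : List.Sublist (a :: s) l) {n : ℕ} (h : firstTails f l n = true) :
    (∃ t, List.Sublist s t ∧ f a t = true) ∨ List.Sublist (a :: s) (l.drop n) := by
  induction l generalizing n with
  | nil => cases hs
  | cons b l ih =>
    obtain _ | n := n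
    · exact .inr hs
    obtain ⟨h1, h2⟩ := of_both (p := f b l) (q := firstTails f l n) h
    cases hs with
    | cons _ hs => exact ih hs h2
    | cons_cons _ hs => exact .inl ⟨l, hs, h1⟩

/-- The test for a third set `c` of nine elements, after two that sum to `p`, that the remaining
elements are not the union of three Sidon sets of eight elements, and contain no set from `l`. -/
noncomputable def thirdTest (p c : ℕ) (l : List ℕ) : Bool :=
  both (untriple (Nat.sub (nat_lit 3873095679538626558) (Nat.add p c)))
    (List.rec true (fun _ _ _ => false)
      (disjointFrom (Nat.mod c (nat_lit 4503599627370496)) l))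

/-- The test for all triples of disjoint sets of nine elements that start with `a`. -/
noncomputable def triplesTest (a : ℕ) (l : List ℕ) : Bool :=
  everyTail
    (fun b l =>
      everyTail (thirdTest (Nat.add a b)) (disjointFrom (Nat.mod b (nat_lit 4503599627370496)) l))
    (disjointFrom (Nat.mod a (nat_lit 4503599627370496)) l)

/-- The test for all triples that start in a given block of the list `nines`. -/
noncomputable def triplesFrom (i : ℕ) : Bool :=
  firstTails triplesTest (nines.drop (40 * i)) 40

theorem triplesFrom_lt_six : ∀ i < 6, triplesFrom (0 + i) = true := by
  decide +kernel

theorem triplesFrom_lt_twelve : ∀ i < 6, triplesFrom (6 + i) = true := by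
  decide +kernel

theorem triplesFrom_lt_eighteen : ∀ i < 6, triplesFrom (12 + i) = true := by
  decide +kernel

theorem triplesFrom_lt_thirty_one : ∀ i < 13, triplesFrom (18 + i) = true := by
  decide +kernel

theorem exists_triplesTest {a : ℕ} {s : List ℕ} (hs : List.Sublist (a :: s) nines) :
    ∃ t, List.Sublist s t ∧ triplesTest a t = true := by
  by_contra hne
  have step : ∀ i, List.Sublist (a :: s) (nines.drop (40 * i)) → triplesFrom i = true →
      List.Sublist (a :: s) (nines.drop (40 * (i + 1))) := by
    intro i hi h
    have := (firstTails_sound hi h).resolve_left hne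
    rwa [List.drop_drop] at this
  have block : ∀ k n, List.Sublist (a :: s) (nines.drop (40 * k)) →
      (∀ i < n, triplesFrom (k + i) = true) →
      List.Sublist (a :: s) (nines.drop (40 * (k + n))) := by
    intro k n hk
    induction n with
    | zero => exact fun _ => hk
    | succ n ih =>
      exact fun h => step _ (ih fun i hi => h i (hi.trans n.lt_succ_self)) (h n n.lt_succ_self)
  have h := block 18 13 (block 12 6 (block 6 6 (block 0 6 hs triplesFrom_lt_six)
    triplesFrom_lt_twelve) triplesFrom_lt_eighteen) triplesFrom_lt_thirty_one
  have hlen : nines.length ≤ 40 * (18 + 13) := by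
    decide +kernel
  rw [List.drop_eq_nil_of_le hlen] at h
  cases h

theorem untriple_of_sublist {a b c : ℕ} {s : List ℕ}
    (hs : List.Sublist (a :: b :: c :: s) nines)
    (hd : (a :: b :: c :: s).Pairwise fun x y => Nat.land (x % 2 ^ 52) y = 0) :
    s = [] ∧ untriple (code (Icc 1 51) - (a + b + c)) = true := by
  simp only [List.pairwise_cons] at hd
  obtain ⟨ha, hb, hc, -⟩ := hd
  obtain ⟨t, ht, h⟩ := exists_triplesTest hs
  obtain ⟨t, ht, h⟩ := everyTail_sound (sublist_disjointFrom ht ha) h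
  obtain ⟨t, ht, h⟩ := everyTail_sound (sublist_disjointFrom ht hb) h
  obtain ⟨h1, h2⟩ := of_both h
  have hcode : code (Icc 1 51) = 3873095679538626558 := by
    decide +kernel
  refine ⟨?_, hcode ▸ h1⟩
  have ht := sublist_disjointFrom ht hc
  change (List.rec true (fun _ _ _ => false) (disjointFrom (c % 2 ^ 52) t) : Bool) = true at h2
  generalize disjointFrom (c % 2 ^ 52) t = u at ht h2
  obtain _ | _ := u
  · exact List.sublist_nil.1 ht
  · cases h2

theorem not_exists_sidon_partition (F : Fin 6 → Finset ℕ) (hF : ∀ i, Sidon (F i))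
    (hd : ∀ i j, i ≠ j → Disjoint (F i) (F j)) (hU : univ.biUnion F = Icc 1 51) : False := by
  have hF' : ∀ i, F i ⊆ Icc 1 51 := fun i => hU ▸ subset_biUnion_of_mem F (mem_univ i)
  have hpd : ((univ : Finset (Fin 6)) : Set (Fin 6)).PairwiseDisjoint F := fun i _ j _ h => hd i j h
  have hsum : ∑ i, #(F i) = 51 := by
    rw [← card_biUnion hpd, hU]
    rfl
  have hcode : ∑ i, code (F i) = code (Icc 1 51) := by
    rw [← hU, code, sum_biUnion hpd]
    rfl
  have h9 : ∀ i, #(F i) ≤ 9 := fun i => (hF i).card_le (hF' i)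
  have hland : ∀ i j, i ≠ j → Nat.land (code (F i) % 2 ^ 52) (code (F j)) = 0 := by
    intro i j h
    rw [code_mod (hF' i), land_mask_code (hF' i) (hF' j), disjoint_iff_inter_eq_empty.1 (hd i j h)]
    rfl
  set I : Finset (Fin 6) := {i | #(F i) = 9}
  have hIcard : 3 ≤ #I := by
    have h : ∑ i, #(F i) ≤ ∑ i, (8 + if i ∈ I then 1 else 0) := by
      refine sum_le_sum fun i _ => ?_
      have := h9 i
      split_ifs with h
      · exact this
      · have : #(F i) ≠ 9 := fun e => h (mem_filter.2 ⟨mem_univ i, e⟩)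
        omega
    rw [hsum, sum_add_distrib, sum_boole] at h
    simp at h
    omega
  have hinj : Set.InjOn (fun i => code (F i)) (I : Set (Fin 6)) := by
    intro i hi j hj e
    by_contra hij
    have h := hland i j hij
    rw [← show code (F i) = code (F j) from e, code_mod (hF' i), land_mask_code (hF' i) (hF' i),
      inter_self, mask, sum_eq_zero_iff] at h
    have hne : (F i).Nonempty := by
      rw [← card_pos, (mem_filter.1 hi).2]
      norm_num
    obtain ⟨x, hx⟩ := hne
    exact absurd (h x hx) (by positivity)
  obtain ⟨L, hL⟩ : ∃ L, L = (nines.filter (· ∈ I.image fun i => code (F i))).dedup := ⟨_, rfl⟩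
  have hLsub : List.Sublist L nines := hL ▸ (List.dedup_sublist _).trans List.filter_sublist
  have hLnd : L.Nodup := hL ▸ List.nodup_dedup _
  have hLI : L.toFinset = I.image fun i => code (F i) := by
    ext x
    simp only [hL, List.mem_toFinset, List.mem_dedup, List.mem_filter, decide_eq_true_iff,
      and_iff_right_iff_imp]
    intro h
    obtain ⟨i, hi, rfl⟩ := mem_image.1 h
    exact code_mem_nines (hF i) (hF' i) (mem_filter.1 hi).2
  have hLlen : L.length = #I := by
    rw [← List.toFinset_card_of_nodup hLnd, hLI, card_image_of_injOn hinj]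
  have hLd : L.Pairwise fun x y => Nat.land (x % 2 ^ 52) y = 0 := by
    refine hLnd.imp_of_mem fun {x y} hx hy hxy => ?_
    rw [← List.mem_toFinset, hLI, mem_image] at hx hy
    obtain ⟨i, -, rfl⟩ := hx
    obtain ⟨j, -, rfl⟩ := hy
    exact hland i j fun e => hxy (e ▸ rfl)
  have hLsum : L.sum = ∑ i ∈ I, code (F i) := by
    rw [← sum_image (f := fun x => x) hinj, ← hLI, List.sum_toFinset _ hLnd, List.map_id']
  obtain _ | ⟨a, _ | ⟨b, _ | ⟨c, s⟩⟩⟩ := L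
  any_goals
    simp only [List.length_cons, List.length_nil] at hLlen
    omega
  obtain ⟨rfl, h⟩ := untriple_of_sublist hLsub hLd
  have hIc : #Iᶜ = 3 := by
    rw [card_compl, ← hLlen]
    rfl
  have hle : ∀ i ∈ Iᶜ, #(F i) ≤ 8 := by
    intro i hi
    have h1 : #(F i) ≠ 9 := fun e => mem_compl.1 hi (mem_filter.2 ⟨mem_univ i, e⟩)
    have := h9 i
    omega
  have h8 : ∀ i ∈ Iᶜ, #(F i) = 8 := by
    refine (sum_eq_sum_iff_of_le hle).1 ?_
    have e : ∑ i ∈ I, #(F i) = 27 := by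
      rw [sum_congr rfl fun i hi => (mem_filter.1 hi).2, sum_const, ← hLlen]
      rfl
    have := sum_add_sum_compl I fun i => #(F i)
    rw [sum_const, hIc, smul_eq_mul]
    omega
  set e := Iᶜ.orderIsoOfFin hIc
  have hrest : ∑ i ∈ Iᶜ, code (F i) = code (F (e 0)) + code (F (e 1)) + code (F (e 2)) := by
    rw [← Fin.sum_univ_three (fun j => code (F (e j))), ← sum_coe_sort]
    exact (Equiv.sum_comp e.toEquiv fun i : (Iᶜ : Finset _) => code (F i)).symm
  have hfinal : code (Icc 1 51) - (a + b + c) =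
      code (F (e 0)) + code (F (e 1)) + code (F (e 2)) := by
    have := sum_add_sum_compl I fun i => code (F i)
    simp only [List.sum_cons, List.sum_nil] at hLsum
    omega
  rw [hfinal] at h
  exact untriple_sound (A := fun j => F (e j)) (fun j => hF _) (fun j => hF' _)
    (fun j k hjk => hd _ _ fun h => hjk (e.injective (Subtype.ext h)))
    (fun j => h8 _ (e j).2) h

theorem not_sidonPartition_fifty_one : ¬ SidonPartition 51 6 := by
  rintro ⟨P, hP, hd, hU⟩
  classical
  have hmem : ∀ i x, x ∈ ({x ∈ Icc 1 51 | (x : ℤ) ∈ P i} : Finset ℕ) ↔ (x : ℤ) ∈ P i := by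
    intro i x
    rw [mem_filter, and_iff_right_iff_imp]
    intro h
    have := hU ▸ Set.mem_iUnion_of_mem i h
    simp only [Set.mem_Icc] at this
    rw [mem_Icc]
    omega
  refine not_exists_sidon_partition (fun i => {x ∈ Icc 1 51 | (x : ℤ) ∈ P i}) (fun i => ?_)
    (fun i j hij => ?_) ?_
  · intro a ha b hb c hc d hd e
    rw [hmem] at ha hb hc hd
    have := hP i a ha b hb c hc d hd (by exact_mod_cast e)
    rw [Set.pair_eq_pair_iff] at this
    exact_mod_cast this
  · rw [disjoint_left]
    intro x hx hx'
    rw [hmem] at hx hx'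
    exact Set.disjoint_left.1 (hd i j hij) hx hx'
  · ext x
    simp only [mem_biUnion, mem_univ, true_and, mem_filter, exists_and_left, and_iff_left_iff_imp]
    intro hx
    rw [← Set.mem_iUnion, hU, Set.mem_Icc]
    rw [mem_Icc] at hx
    omega

/-- A partition of `[1,50]` into six Sidon sets. -/
def sidonParts : Fin 6 → Finset ℕ :=
  ![{2, 5, 11, 18, 22, 23, 37, 45, 47},
    {4, 6, 14, 28, 29, 33, 40, 46, 49},
    {1, 13, 15, 26, 31, 34, 35, 41},
    {3, 7, 8, 24, 30, 32, 39, 42},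
    {9, 12, 19, 21, 27, 43, 44, 48},
    {10, 16, 17, 20, 25, 36, 38, 50}]

theorem sidon_sidonParts (i : Fin 6) : Sidon (sidonParts i) := by
  unfold Sidon
  revert i
  decide +kernel

theorem disjoint_sidonParts : ∀ i j, i ≠ j → Disjoint (sidonParts i) (sidonParts j) := by
  decide +kernel

theorem biUnion_sidonParts : univ.biUnion sidonParts = Icc 1 50 := by
  decide +kernel

theorem sidonPartition_of_le {n : ℕ} (hn : n ≤ 50) : SidonPartition n 6 := by
  refine ⟨fun i => (↑) '' {a : ℕ | a ∈ sidonParts i ∧ a ≤ n}, fun i => ?_, fun i j hij => ?_, ?_⟩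
  · rintro _ ⟨a, ha, rfl⟩ _ ⟨b, hb, rfl⟩ _ ⟨c, hc, rfl⟩ _ ⟨d, hd, rfl⟩ e
    rw [Set.pair_eq_pair_iff]
    exact_mod_cast sidon_sidonParts i a ha.1 b hb.1 c hc.1 d hd.1 (by exact_mod_cast e)
  · rw [Set.disjoint_left]
    rintro _ ⟨a, ha, rfl⟩ ⟨b, hb, e⟩
    obtain rfl := Int.ofNat_inj.1 e
    exact Finset.disjoint_left.1 (disjoint_sidonParts i j hij) ha.1 hb.1
  · have hU : ∀ a, (∃ i, a ∈ sidonParts i) ↔ 1 ≤ a ∧ a ≤ 50 := by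
      intro a
      rw [← mem_Icc, ← biUnion_sidonParts]
      simp
    ext x
    simp only [Set.mem_iUnion, Set.mem_image, Set.mem_ofPred_eq, Set.mem_Icc]
    constructor
    · rintro ⟨i, a, ⟨ha, han⟩, rfl⟩
      have := (hU a).1 ⟨i, ha⟩
      omega
    · rintro ⟨h1, h2⟩
      obtain ⟨i, hi⟩ := (hU x.toNat).2 (by omega)
      exact ⟨i, x.toNat, ⟨hi, by omega⟩, by omega⟩

end SidonRamsey

theorem SR_six : ¬ SidonPartition 51 6 ∧ SR 6 = 51 := by
  have h51 := SidonRamsey.not_sidonPartition_fifty_one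
  refine ⟨h51, le_antisymm (Nat.sInf_le h51) (le_csInf ⟨51, h51⟩ fun n hn => ?_)⟩
  by_contra! h
  exact hn (SidonRamsey.sidonPartition_of_le (Nat.le_of_lt_succ h))
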